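/- Let Ω ∈ K^{n×ℓ} and Ψ ∈ K^{d×k} be any random embeddings that have full column rank almost surely, with ℓ + α_K < k. For any rank parameters q, r ∈ ℕ with q + α_K ≤ ℓ and k ≤ r ≤ min(d, n), the supremum over all matrices A ∈ K^{d×n} with rank(A) = r of the ratio E‖A − A⟨Ω,Ψ⟩‖_F² / ‖A − [A]_q‖_F² is at least (1 + ((d − k)/(d − ℓ)) · ℓ/(k − ℓ − α_K)) · ((r − ℓ)/(r − q)) · (1 + q/(ℓ − q − α_K)). -/

import Mathlib

open MeasureTheory ProbabilityTheory Matrix Filter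
open scoped ENNReal Topology ComplexOrder

noncomputable section

open Classical in
/-- `α_K`: 1 if `K = ℝ`, 0 if `K = ℂ`. -/
def alphaK (K : Type*) [RCLike K] : ℝ := if (RCLike.I : K) = 0 then 1 else 0

/-- Squared Frobenius norm of a matrix. -/
def frobSq {K : Type*} [RCLike K] {m n : Type*} [Fintype m] [Fintype n]
    (A : Matrix m n K) : ℝ := ∑ i, ∑ j, ‖A i j‖ ^ 2

/-- The four Penrose conditions characterizing the Moore–Penrose pseudoinverse. -/
def IsMoorePenrose {K : Type*} [RCLike K] {m n : Type*} [Fintype m] [Fintype n]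
    (A : Matrix m n K) (X : Matrix n m K) : Prop :=
  A * X * A = A ∧ X * A * X = X ∧ (A * X)ᴴ = A * X ∧ (X * A)ᴴ = X * A

instance matrixMeasurableSpace {m n α : Type*} [MeasurableSpace α] :
    MeasurableSpace (Matrix m n α) :=
  inferInstanceAs (MeasurableSpace (m → n → α))

/-- `M` is rotation-invariant: `U * M` has the same distribution as `M` for every unitary `U`. -/
def RotationInvariant {K : Type*} [RCLike K] [MeasurableSpace K]
    {Y : Type*} [MeasurableSpace Y] (μ : Measure Y) {n ℓ : ℕ}
    (M : Y → Matrix (Fin n) (Fin ℓ) K) : Prop :=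
  ∀ U : Matrix (Fin n) (Fin n) K, U ∈ Matrix.unitaryGroup (Fin n) K →
    Measure.map (fun ω => U * M ω) μ = Measure.map M μ

/-- `M` is a random orthonormal embedding: rotation-invariant, with orthonormal
columns almost surely. -/
def IsRandomOrthonormal {K : Type*} [RCLike K] [MeasurableSpace K]
    {Y : Type*} [MeasurableSpace Y] (μ : Measure Y) {n ℓ : ℕ}
    (M : Y → Matrix (Fin n) (Fin ℓ) K) : Prop :=
  Measurable M ∧ RotationInvariant μ M ∧ ∀ᵐ ω ∂μ, (M ω)ᴴ * M ω = 1

/-- `Aq` is a best rank-`q` approximation of `A` in Frobenius norm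
(equivalently, a matrix obtained from a `q`-truncated SVD of `A`). -/
def IsBestRankApprox {K : Type*} [RCLike K] {m n : Type*} [Fintype m] [Fintype n]
    [DecidableEq n] (q : ℕ) (A Aq : Matrix m n K) : Prop :=
  Aq.rank ≤ q ∧ ∀ B : Matrix m n K, B.rank ≤ q → frobSq (A - Aq) ≤ frobSq (A - B)

/-! ### Gaussian-type measures: probability measures of the form `exp(-N) d(Haar)` -/

/-- `ν` is the probability measure with density proportional to `exp (-N)`. -/
def IsG {X : Type*} [AddCommGroup X] [TopologicalSpace X] [MeasurableSpace X]
    (N : X → ℝ) (ν : Measure X) : Prop :=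
  IsProbabilityMeasure ν ∧ ∃ m : Measure X, m.IsAddHaarMeasure ∧
    ν = m.withDensity (fun x => ENNReal.ofReal (Real.exp (-N x)))

lemma IsG.unique {X : Type*} [AddCommGroup X] [TopologicalSpace X] [IsTopologicalAddGroup X]
    [LocallyCompactSpace X] [SecondCountableTopology X] [MeasurableSpace X] [BorelSpace X]
    {N : X → ℝ} {ν ν' : Measure X} (h : IsG N ν) (h' : IsG N ν') : ν = ν' := by
  obtain ⟨hp, m, hm, rfl⟩ := h
  obtain ⟨hp', m', hm', rfl⟩ := h'
  have e := Measure.isAddLeftInvariant_eq_smul m' m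
  set c := m'.addHaarScalarFactor m
  have e1 : m' = (c : ℝ≥0∞) • m := e
  rw [e1, withDensity_smul_measure] at hp' ⊢
  have h1 := hp'.measure_univ
  rw [Measure.smul_apply, hp.measure_univ, smul_eq_mul, mul_one] at h1
  rw [h1, one_smul]

lemma IsG.map {X Y : Type*} [AddCommGroup X] [TopologicalSpace X] [IsTopologicalAddGroup X]
    [MeasurableSpace X] [BorelSpace X]
    [AddCommGroup Y] [TopologicalSpace Y] [IsTopologicalAddGroup Y]
    [MeasurableSpace Y] [BorelSpace Y]
    {N : X → ℝ} {N' : Y → ℝ} {ν : Measure X} (h : IsG N ν) (e : X ≃+ Y)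
    (he : Continuous e) (he' : Continuous e.symm) (hN' : Measurable N')
    (hN : ∀ x, N' (e x) = N x) : IsG N' (Measure.map e ν) := by
  obtain ⟨hp, m, hm, rfl⟩ := h
  refine ⟨Measure.isProbabilityMeasure_map he.measurable.aemeasurable, Measure.map e m,
    e.isAddHaarMeasure_map m he he', ?_⟩
  ext s hs
  rw [Measure.map_apply he.measurable hs, withDensity_apply _ hs,
    withDensity_apply _ (he.measurable hs), setLIntegral_map hs (by fun_prop) he.measurable]
  simp [hN]

lemma IsG.pi {X ι : Type*} [Fintype ι] [AddCommGroup X] [TopologicalSpace X]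
    [IsTopologicalAddGroup X]
    [LocallyCompactSpace X] [SecondCountableTopology X] [MeasurableSpace X] [BorelSpace X]
    {N : X → ℝ} (hN : Measurable N) {ν : Measure X} (h : IsG N ν) :
    IsG (fun x : ι → X => ∑ i, N (x i)) (Measure.pi fun _ => ν) := by
  obtain ⟨hp, m, hm, hν⟩ := h
  refine ⟨inferInstance, Measure.pi fun _ => m, inferInstance, ?_⟩
  have hIntg : Integrable (fun x => Real.exp (-N x)) m := by
    refine ⟨by fun_prop, ?_⟩
    rw [hasFiniteIntegral_iff_ofReal (Filter.Eventually.of_forall fun x => (Real.exp_pos _).le)]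
    have := hp.measure_univ
    rw [hν, withDensity_apply _ MeasurableSet.univ, setLIntegral_univ] at this
    rw [this]; exact ENNReal.one_lt_top
  refine Measure.pi_eq fun s hs => ?_
  rw [withDensity_apply _ (MeasurableSet.univ_pi hs), ← lintegral_indicator (MeasurableSet.univ_pi hs)]
  have h1 : ∀ x : ι → X, (Set.univ.pi s).indicator
      (fun x => ENNReal.ofReal (Real.exp (-∑ i, N (x i)))) x =
      ENNReal.ofReal (∏ i, (s i).indicator (fun x => Real.exp (-N x)) (x i)) := by
    intro x
    by_cases hx : x ∈ Set.univ.pi s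
    · rw [Set.indicator_of_mem hx, ← Finset.sum_neg_distrib, Real.exp_sum]
      congr 1
      refine Finset.prod_congr rfl fun i _ => ?_
      rw [Set.indicator_of_mem (hx i trivial)]
    · rw [Set.indicator_of_notMem hx]
      simp only [Set.mem_pi, Set.mem_univ, forall_const, not_forall] at hx
      obtain ⟨i, hi⟩ := hx
      rw [Finset.prod_eq_zero (Finset.mem_univ i) (Set.indicator_of_notMem hi _)]
      simp
  simp_rw [h1]
  have hIntg' : ∀ i, Integrable ((s i).indicator fun x => Real.exp (-N x)) m :=
    fun i => hIntg.indicator (hs i)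
  have hnn : ∀ i x, 0 ≤ (s i).indicator (fun x => Real.exp (-N x)) x := fun i x =>
    Set.indicator_nonneg (fun _ _ => (Real.exp_pos _).le) _
  rw [← ofReal_integral_eq_lintegral_ofReal (Integrable.fintype_prod hIntg')
    (Filter.Eventually.of_forall fun x => Finset.prod_nonneg fun i _ => hnn i _),
    integral_fintype_prod_eq_prod, ENNReal.ofReal_prod_of_nonneg
      (fun i _ => integral_nonneg (hnn i))]
  refine Finset.prod_congr rfl fun i _ => ?_
  rw [ofReal_integral_eq_lintegral_ofReal (hIntg' i) (Filter.Eventually.of_forall (hnn i)), hν,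
    withDensity_apply _ (hs i), ← lintegral_indicator (hs i)]
  refine lintegral_congr fun x => ?_
  by_cases hx : x ∈ s i <;> simp [hx]

lemma exists_gaussK (K : Type*) [RCLike K] [MeasurableSpace K] [BorelSpace K] :
    ∃ ν : Measure K, IsG (fun z : K => ‖z‖ ^ 2) ν := by
  have hIntg : Integrable (fun z : K => Real.exp (-‖z‖ ^ 2)) (Measure.addHaar : Measure K) := by
    have h0 := (integrable_one_add_norm (E := K) (μ := Measure.addHaar)
      (r := (Module.finrank ℝ K : ℝ) + 1) (by linarith)).const_mul
        (Real.exp (((Module.finrank ℝ K : ℝ) + 1) ^ 2))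
    refine h0.mono' (by fun_prop) (Filter.Eventually.of_forall fun z => ?_)
    rw [Real.norm_of_nonneg (Real.exp_pos _).le]
    set r := (Module.finrank ℝ K : ℝ) + 1
    have hr : 0 ≤ r := by positivity
    have hz := norm_nonneg z
    rw [Real.rpow_neg (by positivity), ← div_eq_mul_inv, le_div_iff₀ (by positivity)]
    have h1 : (1 + ‖z‖) ^ r ≤ Real.exp (‖z‖ * r) := by
      rw [Real.exp_mul]
      exact Real.rpow_le_rpow (by positivity) (by linarith [Real.add_one_le_exp ‖z‖]) hr
    calc _ ≤ Real.exp (-‖z‖ ^ 2) * Real.exp (‖z‖ * r) := by gcongr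
      _ = Real.exp (-‖z‖ ^ 2 + ‖z‖ * r) := (Real.exp_add _ _).symm
      _ ≤ _ := Real.exp_le_exp.2 (by nlinarith [sq_nonneg (‖z‖ - r)])
  have hfin : ∫⁻ z : K, ENNReal.ofReal (Real.exp (-‖z‖ ^ 2)) ∂Measure.addHaar ≠ ∞ :=
    (hasFiniteIntegral_iff_ofReal
      (Filter.Eventually.of_forall fun x => (Real.exp_pos _).le)).1 hIntg.2 |>.ne
  have hpos : ∫⁻ z : K, ENNReal.ofReal (Real.exp (-‖z‖ ^ 2)) ∂Measure.addHaar ≠ 0 := by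
    rw [Ne, lintegral_eq_zero_iff (by fun_prop)]
    intro h
    have h2 : ∀ᵐ z : K ∂Measure.addHaar, False := by
      filter_upwards [h] with z hz
      simp [Real.exp_pos] at hz
      exact absurd hz (not_le.2 (Real.exp_pos _))
    rw [Filter.eventually_false_iff_eq_bot] at h2
    exact (NeZero.ne (Measure.addHaar : Measure K)) (ae_eq_bot.1 h2)
  set I0 := ∫⁻ z : K, ENNReal.ofReal (Real.exp (-‖z‖ ^ 2)) ∂Measure.addHaar
  refine ⟨(I0⁻¹ • Measure.addHaar).withDensity (fun x => ENNReal.ofReal (Real.exp (-‖x‖ ^ 2))),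
    ⟨?_⟩, I0⁻¹ • Measure.addHaar,
    Measure.IsAddHaarMeasure.smul _ (ENNReal.inv_ne_zero.2 hfin) (ENNReal.inv_ne_top.2 hpos), rfl⟩
  rw [withDensity_smul_measure, Measure.smul_apply, withDensity_apply _ MeasurableSet.univ,
    setLIntegral_univ, smul_eq_mul]
  exact ENNReal.inv_mul_cancel hpos hfin

/-- Standard Gaussian-type measure on `K`, density proportional to `exp (-‖z‖²)`. -/
def gK (K : Type*) [RCLike K] [MeasurableSpace K] [BorelSpace K] : Measure K :=
  (exists_gaussK K).choose

/-- Half the real dimension of `K`. -/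
def bK (K : Type*) [RCLike K] : ℝ := (Module.finrank ℝ K : ℝ) / 2

section
variable {K : Type*} [RCLike K] [MeasurableSpace K] [BorelSpace K]

lemma gK_isG : IsG (fun z : K => ‖z‖ ^ 2) (gK K) := (exists_gaussK K).choose_spec

instance : IsProbabilityMeasure (gK K) := gK_isG.1

lemma bK_eq : bK K * (1 + alphaK K) = 1 ∧ 0 < bK K ∧ bK K ≤ 1 := by
  unfold bK alphaK
  by_cases h : (RCLike.I : K) = 0
  · rw [if_pos h, (RCLike.realLinearIsometryEquiv h).toLinearEquiv.finrank_eq]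
    simp; norm_num
  · rw [if_neg h]
    have h1 : RCLike.im (RCLike.I : K) = 1 := by
      rcases RCLike.I_eq_zero_or_im_I_eq_one (K := K) with h' | h'
      · exact absurd h' h
      · exact h'
    rw [(RCLike.complexLinearIsometryEquiv h1).toLinearEquiv.finrank_eq]
    simp

lemma gK_exp {u : ℝ} (hu : 0 < u) :
    ∫⁻ z : K, ENNReal.ofReal (Real.exp (-((u - 1) * ‖z‖ ^ 2))) ∂(gK K) =
      ENNReal.ofReal (u ^ (-bK K)) := by
  obtain ⟨hp, m, hm, hν⟩ := gK_isG (K := K)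
  have h1 : ∫⁻ x : K, ENNReal.ofReal (Real.exp (-‖x‖ ^ 2)) ∂m = 1 := by
    have := hp.measure_univ
    rwa [hν, withDensity_apply _ MeasurableSet.univ, setLIntegral_univ] at this
  rw [hν, lintegral_withDensity_eq_lintegral_mul _ (by fun_prop) (by fun_prop)]
  have h2 : ∀ z : K, (fun x : K => ENNReal.ofReal (Real.exp (-‖x‖ ^ 2))) z *
      ENNReal.ofReal (Real.exp (-((u - 1) * ‖z‖ ^ 2))) =
      (fun x : K => ENNReal.ofReal (Real.exp (-‖x‖ ^ 2))) ((Real.sqrt u) • z) := by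
    intro z
    simp only
    rw [← ENNReal.ofReal_mul (Real.exp_pos _).le, ← Real.exp_add, norm_smul, mul_pow,
      Real.norm_of_nonneg (Real.sqrt_nonneg _), Real.sq_sqrt hu.le]
    congr 2; ring
  simp only [Pi.mul_apply]
  simp_rw [h2]
  have hs : Real.sqrt u ≠ 0 := (Real.sqrt_pos.2 hu).ne'
  rw [← lintegral_map (f := fun x : K => ENNReal.ofReal (Real.exp (-‖x‖ ^ 2))) (by fun_prop)
    (by fun_prop), Measure.map_addHaar_smul m hs, lintegral_smul_measure, h1, smul_eq_mul, mul_one]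
  congr 1
  rw [abs_of_nonneg (by positivity), Real.rpow_neg hu.le, bK, Real.sqrt_eq_rpow,
    ← Real.rpow_natCast, ← Real.rpow_mul hu.le]
  congr 2; ring

lemma gK_sq : ENNReal.ofReal (bK K) ≤ ∫⁻ z : K, ENNReal.ofReal (‖z‖ ^ 2) ∂(gK K) := by
  set I := ∫⁻ z : K, ENNReal.ofReal (‖z‖ ^ 2) ∂(gK K)
  by_cases hI : I = ∞
  · rw [hI]; exact le_top
  obtain ⟨-, hb0, hb1⟩ := bK_eq (K := K)
  have key : ∀ s : ℝ, 0 < s → bK K ≤ (1 + s) * I.toReal := by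
    intro s hs
    have h1 : (1 : ℝ≥0∞) ≤ ENNReal.ofReal ((1 + s) ^ (-bK K)) + ENNReal.ofReal s * I := by
      rw [← gK_exp (by linarith), ← lintegral_const_mul _ (by fun_prop),
        ← lintegral_add_left (by fun_prop)]
      calc (1 : ℝ≥0∞) = ∫⁻ z : K, 1 ∂(gK K) := by simp
        _ ≤ _ := by
          refine lintegral_mono fun z => ?_
          rw [← ENNReal.ofReal_mul hs.le, ← ENNReal.ofReal_add (Real.exp_pos _).le (by positivity),
            ← ENNReal.ofReal_one]
          refine ENNReal.ofReal_le_ofReal ?_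
          have := Real.add_one_le_exp (-((1 + s - 1) * ‖z‖ ^ 2))
          linarith
    have hI' : I = ENNReal.ofReal I.toReal := (ENNReal.ofReal_toReal hI).symm
    rw [hI', ← ENNReal.ofReal_mul hs.le, ← ENNReal.ofReal_add (by positivity) (by positivity),
      ENNReal.one_le_ofReal] at h1
    have h2 : (1 + s) ^ (-bK K) ≤ 1 - bK K * (s / (1 + s)) := by
      have h3 : (1 + s) ^ (-bK K) = (1 + (-(s / (1 + s)))) ^ bK K := by
        rw [Real.rpow_neg (by linarith), ← Real.inv_rpow (by linarith)]
        congr 1; field_simp; ring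
      rw [h3]
      have h4 : s / (1 + s) ≤ 1 := by rw [div_le_one (by linarith)]; linarith
      have := rpow_one_add_le_one_add_mul_self (s := -(s / (1 + s))) (by linarith) hb0.le hb1
      linarith
    have h5 : bK K * (s / (1 + s)) ≤ s * I.toReal := by linarith
    have h6 : bK K * (s / (1 + s)) = (bK K / (1 + s)) * s := by ring
    rw [h6, mul_comm s] at h5
    have h7 := le_of_mul_le_mul_right h5 hs
    rw [div_le_iff₀ (by linarith)] at h7
    linarith
  have : bK K ≤ I.toReal := by
    have ht : Tendsto (fun s : ℝ => (1 + s) * I.toReal) (𝓝[>] 0) (𝓝 ((1 + 0) * I.toReal)) := by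
      refine Tendsto.mono_left ?_ nhdsWithin_le_nhds
      exact Continuous.tendsto (by fun_prop) 0
    have := ge_of_tendsto ht (by filter_upwards [self_mem_nhdsWithin] with s hs using key s hs)
    simpa using this
  exact (ENNReal.ofReal_le_ofReal this).trans ENNReal.ofReal_toReal_le

lemma gK_exp_vec {a : Type*} [Fintype a] (s : Finset a) {u : ℝ} (hu : 0 < u) :
    ∫⁻ x : a → K, ENNReal.ofReal (Real.exp (-((u - 1) * ∑ i ∈ s, ‖x i‖ ^ 2)))
      ∂(Measure.pi fun _ => gK K) = ENNReal.ofReal (u ^ (-(bK K * s.card))) := by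
  have hf : Measurable fun z : K => ENNReal.ofReal (Real.exp (-((u - 1) * ‖z‖ ^ 2))) := by fun_prop
  have h1 : ∀ x : a → K, ENNReal.ofReal (Real.exp (-((u - 1) * ∑ i ∈ s, ‖x i‖ ^ 2))) =
      ∏ i ∈ s, ENNReal.ofReal (Real.exp (-((u - 1) * ‖x i‖ ^ 2))) := by
    intro x
    rw [Finset.mul_sum, ← Finset.sum_neg_distrib, Real.exp_sum,
      ENNReal.ofReal_prod_of_nonneg (fun i _ => (Real.exp_pos _).le)]
  simp_rw [h1]
  have h2 := lintegral_prod_eq_prod_lintegral_of_indepFun s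
    (fun (i : a) (x : a → K) => ENNReal.ofReal (Real.exp (-((u - 1) * ‖x i‖ ^ 2))))
    (iIndepFun_pi (μ := fun _ : a => gK K)
      (X := fun _ z => ENNReal.ofReal (Real.exp (-((u - 1) * ‖z‖ ^ 2)))) (fun i => hf.aemeasurable))
    (fun i => hf.comp (measurable_pi_apply i))
  rw [h2]
  have h3 : ∀ i, ∫⁻ x : a → K, ENNReal.ofReal (Real.exp (-((u - 1) * ‖x i‖ ^ 2)))
      ∂(Measure.pi fun _ => gK K) = ENNReal.ofReal (u ^ (-bK K)) := by
    intro i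
    rw [← gK_exp hu]
    exact (measurePreserving_eval (fun _ : a => gK K) i).lintegral_comp hf
  simp_rw [h3]
  rw [Finset.prod_const, ← ENNReal.ofReal_pow (by positivity), ← Real.rpow_natCast,
    ← Real.rpow_mul hu.le, neg_mul]

lemma gK_inv_vec {a : Type*} [Fintype a] (s : Finset a) (hs : 1 < bK K * s.card) :
    ENNReal.ofReal (1 / (bK K * s.card - 1)) ≤
      ∫⁻ x : a → K, (ENNReal.ofReal (∑ i ∈ s, ‖x i‖ ^ 2))⁻¹ ∂(Measure.pi fun _ => gK K) := by
  have h1 : ∀ x : a → K, ∫⁻ u in Set.Ioi (1 : ℝ),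
      ENNReal.ofReal (Real.exp (-((u - 1) * ∑ i ∈ s, ‖x i‖ ^ 2))) ≤
      (ENNReal.ofReal (∑ i ∈ s, ‖x i‖ ^ 2))⁻¹ := by
    intro x
    set y := ∑ i ∈ s, ‖x i‖ ^ 2 with hy
    have hy0 : 0 ≤ y := Finset.sum_nonneg fun _ _ => by positivity
    rcases hy0.eq_or_lt with h | h
    · rw [← h]; simp
    · have he : ∀ u : ℝ, Real.exp (-((u - 1) * y)) = Real.exp y * Real.exp (-y * u) := by
        intro u; rw [← Real.exp_add]; congr 1; ring
      simp_rw [he]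
      have hIntg := (integrableOn_exp_mul_Ioi (a := -y) (by linarith) 1).const_mul (Real.exp y)
      rw [← ofReal_integral_eq_lintegral_ofReal hIntg
        (Filter.Eventually.of_forall fun u => by positivity), integral_const_mul,
        integral_exp_mul_Ioi (by linarith), ← ENNReal.ofReal_inv_of_pos h]
      refine ENNReal.ofReal_le_ofReal (le_of_eq ?_)
      rw [mul_one, neg_div_neg_eq, ← mul_div_assoc, ← Real.exp_add]
      simp
  refine le_trans ?_ (lintegral_mono h1)
  rw [lintegral_lintegral_swap (by
    apply Measurable.aemeasurable
    unfold Function.uncurry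
    fun_prop)]
  rw [setLIntegral_congr_fun (g := fun u : ℝ => ENNReal.ofReal (u ^ (-(bK K * s.card))))
    measurableSet_Ioi (fun u hu => gK_exp_vec s (lt_trans one_pos hu))]
  rw [← ofReal_integral_eq_lintegral_ofReal (integrableOn_Ioi_rpow_of_lt (by linarith) one_pos),
    integral_Ioi_rpow_of_lt (by linarith) one_pos]
  · refine ENNReal.ofReal_le_ofReal (le_of_eq ?_)
    rw [Real.one_rpow, ← neg_div_neg_eq]; congr 1; ring
  · filter_upwards [ae_restrict_mem measurableSet_Ioi] with u hu
    have : (0 : ℝ) < u := lt_trans one_pos hu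
    simp only [Pi.zero_apply]; positivity

end

/-! ### Frobenius norm, full rank matrices, projections -/
section algebra
set_option linter.unusedSectionVars false
variable {K : Type*} [RCLike K]
variable {l m n ι a b : Type*} [Fintype l] [Fintype m] [Fintype n] [Fintype ι]
  [DecidableEq l] [DecidableEq m] [DecidableEq n] [DecidableEq ι]

lemma frobSq_nonneg (A : Matrix m n K) : 0 ≤ frobSq A :=
  Finset.sum_nonneg fun _ _ => Finset.sum_nonneg fun _ _ => by positivity

lemma frobSq_conjTranspose (A : Matrix m n K) : frobSq Aᴴ = frobSq A := by
  unfold frobSq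
  rw [Finset.sum_comm]
  simp

lemma frobSq_trace (A : Matrix m n K) : ((frobSq A : ℝ) : K) = (Aᴴ * A).trace := by
  unfold frobSq
  rw [Finset.sum_comm]
  simp only [Matrix.trace, Matrix.diag, Matrix.mul_apply, Matrix.conjTranspose_apply]
  push_cast
  refine Finset.sum_congr rfl fun j _ => Finset.sum_congr rfl fun i _ => ?_
  rw [RCLike.star_def, RCLike.conj_mul]

lemma frobSq_congr {A : Matrix m n K} {B : Matrix l ι K}
    (h : (Aᴴ * A).trace = (Bᴴ * B).trace) : frobSq A = frobSq B := by
  have := (frobSq_trace A).trans (h.trans (frobSq_trace B).symm)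
  exact_mod_cast this

lemma frobSq_isom_mul {W : Matrix m l K} (hW : Wᴴ * W = 1) (A : Matrix l n K) :
    frobSq (W * A) = frobSq A := by
  apply frobSq_congr
  rw [conjTranspose_mul, Matrix.mul_assoc, ← Matrix.mul_assoc Wᴴ, hW, Matrix.one_mul]

lemma frobSq_mul_coisom {W : Matrix l n K} (hW : W * Wᴴ = 1) (A : Matrix m l K) :
    frobSq (A * W) = frobSq A := by
  rw [← frobSq_conjTranspose, conjTranspose_mul, frobSq_isom_mul (by simpa using hW),
    frobSq_conjTranspose]

lemma frobSq_add {A B : Matrix m n K} (h : Aᴴ * B = 0) :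
    frobSq (A + B) = frobSq A + frobSq B := by
  have h' : Bᴴ * A = 0 := by
    have := congrArg conjTranspose h
    simpa using this
  have : ((frobSq (A + B) : ℝ) : K) = ((frobSq A + frobSq B : ℝ) : K) := by
    have e1 := frobSq_trace (A + B)
    rw [conjTranspose_add, Matrix.add_mul, Matrix.mul_add, Matrix.mul_add, h, h', trace_add, add_zero,
      zero_add, ← frobSq_trace A, ← frobSq_trace B] at e1
    rw [e1]
    push_cast
    rfl
  exact_mod_cast this

lemma frobSq_add' {A B : Matrix m n K} (h : A * Bᴴ = 0) :
    frobSq (A + B) = frobSq A + frobSq B := by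
  rw [← frobSq_conjTranspose, conjTranspose_add, frobSq_add (by simpa using h),
    frobSq_conjTranspose, frobSq_conjTranspose]

/-- Full column rank. -/
def FR (Z : Matrix m ι K) : Prop := (Zᴴ * Z).det ≠ 0

lemma FR_iff (Z : Matrix m ι K) : FR Z ↔ ∀ v, Z *ᵥ v = 0 → v = 0 := by
  unfold FR
  rw [← not_iff_not, not_not, ← Matrix.exists_mulVec_eq_zero_iff]
  simp only [conjTranspose_mul_self_mulVec_eq_zero]
  push Not
  exact ⟨fun ⟨v, h1, h2⟩ => ⟨v, h2, h1⟩, fun ⟨v, h1, h2⟩ => ⟨v, h2, h1⟩⟩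

lemma FR_of_left_inv {Z : Matrix m ι K} {Y : Matrix ι m K} (h : Y * Z = 1) : FR Z := by
  rw [FR_iff]
  intro v hv
  have : (Y * Z) *ᵥ v = 0 := by rw [← Matrix.mulVec_mulVec, hv, Matrix.mulVec_zero]
  simpa [h] using this

lemma FR_mul {Z : Matrix m l K} {T : Matrix l ι K} (hZ : FR Z) (hT : FR T) : FR (Z * T) := by
  rw [FR_iff] at *
  intro v hv
  rw [← Matrix.mulVec_mulVec] at hv
  exact hT _ (hZ _ hv)

lemma FR_isom {W : Matrix m l K} (hW : Wᴴ * W = 1) : FR W := FR_of_left_inv hW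

lemma FR_unit {T : Matrix ι ι K} (hT : IsUnit T.det) : FR T :=
  FR_of_left_inv (Matrix.nonsing_inv_mul T hT)

lemma FR_of_rank {Z : Matrix m ι K} (h : Z.rank = Fintype.card ι) : FR Z := by
  unfold FR
  rw [← Matrix.rank_conjTranspose_mul_self] at h
  have h2 : LinearIndependent K (Zᴴ * Z).col := by
    rw [linearIndependent_iff_card_eq_finrank_span, ← h, Matrix.rank_eq_finrank_span_cols]
    rfl
  rw [Matrix.linearIndependent_cols_iff_isUnit] at h2
  exact ((Matrix.isUnit_iff_isUnit_det _).1 h2).ne_zero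

/-- Left inverse of a full column rank matrix. -/
def linv (Z : Matrix m ι K) : Matrix ι m K := (Zᴴ * Z)⁻¹ * Zᴴ

lemma linv_mul {Z : Matrix m ι K} (h : FR Z) : linv Z * Z = 1 := by
  rw [linv, Matrix.mul_assoc]
  exact Matrix.nonsing_inv_mul _ (isUnit_iff_ne_zero.2 h)

lemma linv_mul_unit (Z : Matrix m ι K) {T : Matrix ι ι K} (hT : IsUnit T.det) :
    linv (Z * T) = T⁻¹ * linv Z := by
  unfold linv
  have hT' : IsUnit (Tᴴ).det := by rw [det_conjTranspose]; exact hT.star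
  rw [conjTranspose_mul, show Tᴴ * Zᴴ * (Z * T) = Tᴴ * ((Zᴴ * Z) * T) by
    simp only [Matrix.mul_assoc], Matrix.mul_inv_rev, Matrix.mul_inv_rev]
  simp only [Matrix.mul_assoc]
  rw [← Matrix.mul_assoc (Tᴴ)⁻¹, Matrix.nonsing_inv_mul _ hT', Matrix.one_mul]

lemma linv_isom_mul {W : Matrix m l K} (hW : Wᴴ * W = 1) (Z : Matrix l ι K) :
    linv (W * Z) = linv Z * Wᴴ := by
  unfold linv
  rw [conjTranspose_mul, show Zᴴ * Wᴴ * (W * Z) = Zᴴ * ((Wᴴ * W) * Z) by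
    simp only [Matrix.mul_assoc], hW, Matrix.one_mul]
  simp only [Matrix.mul_assoc]

/-- Orthogonal projection onto the range. -/
def prj (Z : Matrix m ι K) : Matrix m m K := Z * linv Z

lemma prj_herm (Z : Matrix m ι K) : (prj Z)ᴴ = prj Z := by
  unfold prj linv
  simp only [conjTranspose_mul, conjTranspose_conjTranspose, conjTranspose_nonsing_inv,
    Matrix.mul_assoc]

lemma prj_mul {Z : Matrix m ι K} (h : FR Z) : prj Z * Z = Z := by
  rw [prj, Matrix.mul_assoc, linv_mul h, Matrix.mul_one]

lemma prj_sq {Z : Matrix m ι K} (h : FR Z) : prj Z * prj Z = prj Z := by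
  conv_lhs => rw [show prj Z * prj Z = (prj Z * Z) * linv Z by
    rw [Matrix.mul_assoc]; rfl, prj_mul h]
  rfl

lemma prj_mul_unit (Z : Matrix m ι K) {T : Matrix ι ι K} (hT : IsUnit T.det) :
    prj (Z * T) = prj Z := by
  rw [prj, linv_mul_unit Z hT, Matrix.mul_assoc, ← Matrix.mul_assoc T, Matrix.mul_nonsing_inv _ hT,
    Matrix.one_mul, prj]

lemma prj_isom_mul {W : Matrix m l K} (hW : Wᴴ * W = 1) (Z : Matrix l ι K) :
    prj (W * Z) = W * prj Z * Wᴴ := by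
  rw [prj, linv_isom_mul hW, prj]
  simp only [Matrix.mul_assoc]

lemma frobSq_prj {Z : Matrix m ι K} (h : FR Z) : frobSq (prj Z) = Fintype.card ι := by
  have : ((frobSq (prj Z) : ℝ) : K) = ((Fintype.card ι : ℝ) : K) := by
    rw [frobSq_trace, prj_herm, prj_sq h, prj, trace_mul_comm, linv_mul h, trace_one]
    simp
  exact_mod_cast this

/-- An oblique projector with range that of `Z` splits as `prj Z` plus an orthogonal part. -/
lemma frobSq_oblique {Z : Matrix m ι K} {Y : Matrix ι m K} (h : Y * Z = 1) :
    frobSq (Z * Y) = Fintype.card ι + frobSq (Z * Y * (1 - prj Z)) := by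
  have hFR := FR_of_left_inv h
  have h1 : Z * Y * prj Z = prj Z := by
    rw [prj, Matrix.mul_assoc, ← Matrix.mul_assoc Y, h, Matrix.one_mul]
  have h2 : Z * Y = prj Z + Z * Y * (1 - prj Z) := by
    rw [Matrix.mul_sub, h1, Matrix.mul_one]; abel
  conv_lhs => rw [h2]
  rw [frobSq_add', frobSq_prj hFR]
  rw [conjTranspose_mul, conjTranspose_sub, prj_herm, conjTranspose_one, ← Matrix.mul_assoc,
    Matrix.mul_sub, prj_sq hFR, Matrix.mul_one, sub_self, Matrix.zero_mul]

lemma card_le_frobSq_oblique {Z : Matrix m ι K} {Y : Matrix ι m K} (h : Y * Z = 1) :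
    (Fintype.card ι : ℝ) ≤ frobSq (Z * Y) := by
  rw [frobSq_oblique h]; linarith [frobSq_nonneg (Z * Y * (1 - prj Z))]

lemma pinv_eq_linv {Z : Matrix m ι K} (h : FR Z) {X : Matrix ι m K} (hX : IsMoorePenrose Z X) :
    X = linv Z := by
  obtain ⟨h1, -, h3, -⟩ := hX
  have h4 : Zᴴ * Z * X = Zᴴ := by
    have := congrArg conjTranspose h1
    rw [conjTranspose_mul, h3] at this
    rw [Matrix.mul_assoc, this]
  have h5 : linv Z = (Zᴴ * Z)⁻¹ * (Zᴴ * Z * X) := by rw [h4]; rfl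
  rw [h5, Matrix.nonsing_inv_mul_cancel_left _ _ (isUnit_iff_ne_zero.2 h)]

/-- Extend an orthonormal family to a unitary matrix. -/
lemma ext_unitary (v : m → m → K) (s : Set m)
    (h : ∀ i ∈ s, ∀ j ∈ s, ∑ k, star (v i k) * v j k = if i = j then 1 else 0) :
    ∃ W ∈ Matrix.unitaryGroup m K, ∀ i ∈ s, ∀ k, W k i = v i k := by
  have ho : Orthonormal K (s.domRestrict fun i => (WithLp.toLp 2 (v i) : EuclideanSpace K m)) := by
    rw [orthonormal_iff_ite]
    rintro ⟨i, hi⟩ ⟨j, hj⟩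
    have := h i hi j hj
    simp only [Set.domRestrict_apply, EuclideanSpace.inner_eq_star_dotProduct, dotProduct, Pi.star_apply,
      Subtype.mk.injEq]
    rw [← this]
    exact Finset.sum_congr rfl fun k _ => mul_comm _ _
  obtain ⟨b, hb⟩ := ho.exists_orthonormalBasis_extension_of_card_eq (by simp)
  refine ⟨(EuclideanSpace.basisFun m K).toBasis.toMatrix b,
    (EuclideanSpace.basisFun m K).toMatrix_orthonormalBasis_mem_unitary b, fun i hi k => ?_⟩
  rw [Module.Basis.toMatrix_apply, hb i hi]
  simp

/-- Coordinate embedding. -/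
def Ec (K : Type*) [RCLike K] (e : ι → m) : Matrix m ι K := (1 : Matrix m m K).submatrix id e

lemma Ec_isom {e : ι → m} (he : Function.Injective e) : (Ec K e)ᴴ * Ec K e = 1 := by
  ext i j
  simp [Ec, Matrix.mul_apply, Matrix.one_apply, he.eq_iff, eq_comm]

lemma mul_Ec (A : Matrix n m K) (e : ι → m) : A * Ec K e = A.submatrix id e := by
  ext i j
  simp [Ec, Matrix.mul_apply, Matrix.one_apply]

lemma Ec_conj_mul (A : Matrix m n K) (e : ι → m) : (Ec K e)ᴴ * A = A.submatrix e id := by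
  ext i j
  simp [Ec, Matrix.mul_apply, Matrix.one_apply]

open scoped MatrixOrder in
lemma exists_sqrt {Z : Matrix m ι K} (h : FR Z) :
    ∃ R : Matrix ι ι K, IsUnit R.det ∧ Rᴴ * R = Zᴴ * Z := by
  have hp := posSemidef_conjTranspose_mul_self Z
  have h0 : 0 ≤ Zᴴ * Z := nonneg_iff_posSemidef.2 hp
  have h1 : (CFC.sqrt (Zᴴ * Z))ᴴ = CFC.sqrt (Zᴴ * Z) :=
    (nonneg_iff_posSemidef.1 (CFC.sqrt_nonneg (Zᴴ * Z))).isHermitian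
  have h2 : CFC.sqrt (Zᴴ * Z) * CFC.sqrt (Zᴴ * Z) = Zᴴ * Z := CFC.sqrt_mul_sqrt_self _ h0
  refine ⟨CFC.sqrt (Zᴴ * Z), ?_, by rw [h1, h2]⟩
  rw [isUnit_iff_ne_zero]
  intro h3
  apply h
  rw [← h2, det_mul, h3, zero_mul]

lemma exists_unitary_factor {Z : Matrix m ι K} (h : FR Z) {e : ι → m}
    (he : Function.Injective e) :
    ∃ W ∈ Matrix.unitaryGroup m K, ∃ R : Matrix ι ι K, IsUnit R.det ∧ Z = W * Ec K e * R := by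
  obtain ⟨R, hR, hRZ⟩ := exists_sqrt h
  have hQ : (Z * R⁻¹)ᴴ * (Z * R⁻¹) = 1 := by
    have hR' : IsUnit (Rᴴ).det := by rw [det_conjTranspose]; exact hR.star
    rw [conjTranspose_mul, conjTranspose_nonsing_inv, Matrix.mul_assoc, ← Matrix.mul_assoc Zᴴ,
      ← hRZ, Matrix.mul_assoc, Matrix.mul_nonsing_inv _ hR, Matrix.mul_one,
      Matrix.nonsing_inv_mul _ hR']
  obtain ⟨W, hW, hWe⟩ := ext_unitary (K := K)
    (fun i k => if hi : ∃ j, e j = i then (Z * R⁻¹) k hi.choose else 0) (Set.range e) (by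
      rintro _ ⟨i, rfl⟩ _ ⟨j, rfl⟩
      have hc : ∀ i, (if hi : ∃ j, e j = e i then hi.choose else i) = i := by
        intro i
        have hi : ∃ j, e j = e i := ⟨i, rfl⟩
        rw [dif_pos hi]; exact he hi.choose_spec
      have hi : ∃ j, e j = e i := ⟨i, rfl⟩
      have hj : ∃ i, e i = e j := ⟨j, rfl⟩
      simp only [dif_pos hi, dif_pos hj]
      have h1 := he hi.choose_spec
      have h2 := he hj.choose_spec
      rw [h1, h2]
      have := congrFun (congrFun hQ i) j
      rw [Matrix.mul_apply] at this
      simpa [Matrix.one_apply, he.eq_iff] using this)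
  refine ⟨W, hW, R, hR, ?_⟩
  have : W * Ec K e = Z * R⁻¹ := by
    rw [mul_Ec]
    ext k i
    have hi : ∃ j, e j = e i := ⟨i, rfl⟩
    rw [Matrix.submatrix_apply, id, hWe (e i) ⟨i, rfl⟩ k, dif_pos hi, he hi.choose_spec]
  rw [this, Matrix.mul_assoc, Matrix.nonsing_inv_mul _ hR, Matrix.mul_one]

end algebra

/-! ### Measurability on matrices -/
section measmat
set_option linter.unusedSectionVars false
variable {K : Type*} [RCLike K] [MeasurableSpace K] [BorelSpace K]
variable {l m n ι a b : Type*} [Fintype l] [Fintype m] [Fintype n] [Fintype ι]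
  [DecidableEq l] [DecidableEq m] [DecidableEq n] [DecidableEq ι]

instance matBorel : BorelSpace (Matrix m n K) := inferInstanceAs (BorelSpace (m → n → K))
instance matLC : LocallyCompactSpace (Matrix m n K) :=
  inferInstanceAs (LocallyCompactSpace (m → n → K))
instance matSC : SecondCountableTopology (Matrix m n K) :=
  inferInstanceAs (SecondCountableTopology (m → n → K))

variable {X : Type*} [MeasurableSpace X]

lemma meas_mat {f : X → Matrix m n K} (h : ∀ i j, Measurable fun x => f x i j) : Measurable f :=
  measurable_pi_lambda _ fun i => measurable_pi_lambda _ fun j => h i j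

lemma meas_entry {f : X → Matrix m n K} (h : Measurable f) (i : m) (j : n) :
    Measurable fun x => f x i j :=
  (measurable_pi_apply j).comp ((measurable_pi_apply i).comp h)

lemma meas_mul {f : X → Matrix m l K} {g : X → Matrix l n K} (hf : Measurable f)
    (hg : Measurable g) : Measurable fun x => f x * g x := by
  refine meas_mat fun i j => ?_
  simp only [Matrix.mul_apply]
  exact Finset.measurable_sum _ fun k _ => (meas_entry hf i k).mul (meas_entry hg k j)

lemma meas_conjT {f : X → Matrix m n K} (hf : Measurable f) : Measurable fun x => (f x)ᴴ := by
  refine meas_mat fun i j => ?_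
  simp only [Matrix.conjTranspose_apply]
  exact (continuous_star.measurable).comp (meas_entry hf j i)

lemma meas_sub {f g : X → Matrix m n K} (hf : Measurable f)
    (hg : Measurable g) : Measurable fun x => f x - g x :=
  meas_mat fun i j => (meas_entry hf i j).sub (meas_entry hg i j)

lemma meas_det {f : X → Matrix m m K} (hf : Measurable f) : Measurable fun x => (f x).det := by
  simp only [Matrix.det_apply]
  refine Finset.measurable_sum _ fun σ _ => ?_
  refine Measurable.const_smul ?_ _
  exact Finset.measurable_prod _ fun i _ => meas_entry hf _ _

lemma meas_inv {f : X → Matrix m m K} (hf : Measurable f) : Measurable fun x => (f x)⁻¹ := by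
  refine meas_mat fun i j => ?_
  simp only [Matrix.inv_def, Matrix.smul_apply, Matrix.adjugate_apply, smul_eq_mul,
    Ring.inverse_eq_inv']
  refine ((meas_det hf).inv).mul (meas_det ?_)
  refine meas_mat fun i' j' => ?_
  simp only [Matrix.updateRow_apply]
  split_ifs
  · exact measurable_const
  · exact meas_entry hf _ _

lemma meas_linv {f : X → Matrix m ι K} (hf : Measurable f) : Measurable fun x => linv (f x) :=
  meas_mul (meas_inv (meas_mul (meas_conjT hf) hf)) (meas_conjT hf)

lemma meas_prj {f : X → Matrix m ι K} (hf : Measurable f) : Measurable fun x => prj (f x) :=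
  meas_mul hf (meas_linv hf)

lemma meas_frobSq {f : X → Matrix m n K} (hf : Measurable f) :
    Measurable fun x => frobSq (f x) := by
  unfold frobSq
  exact Finset.measurable_sum _ fun i _ => Finset.measurable_sum _ fun j _ =>
    ((meas_entry hf i j).norm).pow_const 2

lemma meas_oF {f : X → Matrix m n K} (hf : Measurable f) :
    Measurable fun x => ENNReal.ofReal (frobSq (f x)) := (meas_frobSq hf).ennreal_ofReal

lemma meas_FR {f : X → Matrix m ι K} (hf : Measurable f) : MeasurableSet {x | FR (f x)} :=
  (meas_det (meas_mul (meas_conjT hf) hf)) (measurableSet_singleton (0 : K)).compl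

lemma measurable_id_mat : Measurable fun Z : Matrix m n K => Z := measurable_id

/-- Standard Gaussian matrix. -/
def Gm (K : Type*) [RCLike K] [MeasurableSpace K] [BorelSpace K] (m n : Type*) [Fintype m]
    [Fintype n] : Measure (Matrix m n K) :=
  (Measure.pi fun _ : m => Measure.pi fun _ : n => gK K : Measure (m → n → K))

instance Gm_prob : IsProbabilityMeasure (Gm K m n) :=
  inferInstanceAs (IsProbabilityMeasure (Measure.pi fun _ : m => Measure.pi fun _ : n => gK K))

lemma Gv_isG : IsG (fun x : n → K => ∑ j, ‖x j‖ ^ 2) (Measure.pi fun _ => gK K) := by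
  have h := IsG.pi (ι := n) (X := K) (N := fun z : K => ‖z‖ ^ 2) (ν := gK K) (by fun_prop) gK_isG
  exact h

lemma Gm_isG : IsG (frobSq : Matrix m n K → ℝ) (Gm K m n) :=
  IsG.pi (ι := m) (X := n → K) (N := fun x : n → K => ∑ j, ‖x j‖ ^ 2)
    (ν := Measure.pi fun _ => gK K) (by fun_prop) Gv_isG

lemma Gm_map {m' n' : Type*} [Fintype m'] [Fintype n']
    [DecidableEq m'] [DecidableEq n'] (e : Matrix m n K ≃+ Matrix m' n' K)
    (he : Continuous e) (he' : Continuous e.symm) (h : ∀ A, frobSq (e A) = frobSq A) :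
    (Gm K m n).map e = Gm K m' n' :=
  IsG.unique (IsG.map Gm_isG e he he' (meas_frobSq measurable_id) h) Gm_isG

lemma unitary_left {W : Matrix m m K} (hW : W ∈ Matrix.unitaryGroup m K) : Wᴴ * W = 1 :=
  Matrix.mem_unitaryGroup_iff'.1 hW
lemma unitary_right {W : Matrix m m K} (hW : W ∈ Matrix.unitaryGroup m K) : W * Wᴴ = 1 :=
  Matrix.mem_unitaryGroup_iff.1 hW

/-- Left multiplication by a unitary. -/
def mulE (W : Matrix m m K) (hW : W ∈ Matrix.unitaryGroup m K) (n : Type*) [Fintype n] :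
    Matrix m n K ≃+ Matrix m n K where
  toFun A := W * A
  invFun A := Wᴴ * A
  left_inv A := by
    show Wᴴ * (W * A) = A
    rw [← Matrix.mul_assoc, unitary_left hW, Matrix.one_mul]
  right_inv A := by
    show W * (Wᴴ * A) = A
    rw [← Matrix.mul_assoc, unitary_right hW, Matrix.one_mul]
  map_add' A B := Matrix.mul_add _ _ _

lemma Gm_mul {W : Matrix m m K} (hW : W ∈ Matrix.unitaryGroup m K) :
    (Gm K m n).map (fun A => W * A) = Gm K m n := by
  refine Gm_map (mulE W hW n) ?_ ?_ fun A => frobSq_isom_mul (unitary_left hW) A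
  · exact continuous_const.matrix_mul continuous_id
  · exact continuous_const.matrix_mul continuous_id

lemma Gm_transpose : (Gm K m n).map (fun A => Aᵀ) = Gm K n m := by
  refine Gm_map (Matrix.transposeAddEquiv m n K) ?_ ?_ fun A => ?_
  · exact continuous_id.matrix_transpose
  · exact continuous_id.matrix_transpose
  · unfold frobSq; rw [Finset.sum_comm]; rfl

lemma lint_mul {W : Matrix m m K} (hW : W ∈ Matrix.unitaryGroup m K)
    {f : Matrix m n K → ℝ≥0∞} (hf : Measurable f) :
    ∫⁻ A, f (W * A) ∂(Gm K m n) = ∫⁻ A, f A ∂(Gm K m n) := by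
  conv_rhs => rw [← Gm_mul hW]
  rw [lintegral_map hf (meas_mul measurable_const measurable_id_mat)]

lemma lint_transpose {f : Matrix n m K → ℝ≥0∞} (hf : Measurable f) :
    ∫⁻ A, f Aᵀ ∂(Gm K m n) = ∫⁻ A, f A ∂(Gm K n m) := by
  rw [← Gm_transpose (m := m) (n := n), lintegral_map hf]
  exact meas_mat fun i j => meas_entry measurable_id j i

/-- Integration over a splitting of the rows. -/
lemma lint_split [Fintype a] [Fintype b] [DecidableEq a] [DecidableEq b] (e : a ⊕ b ≃ m) {f : Matrix m n K → ℝ≥0∞}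
    (hf : Measurable f) :
    ∫⁻ A, f A ∂(Gm K m n) = ∫⁻ A, ∫⁻ B, f ((fromRows A B).submatrix e.symm id)
      ∂(Gm K b n) ∂(Gm K a n) := by
  have h1 := measurePreserving_piCongrLeft
    (fun _ : m => (Measure.pi fun _ : n => gK K : Measure (n → K))) e
  have h2 := (measurePreserving_sumPiEquivProdPi
    (fun _ : a ⊕ b => (Measure.pi fun _ : n => gK K : Measure (n → K)))).symm
  have h3 := h1.comp h2
  have h4 : ∫⁻ A, f A ∂(Gm K m n) = ∫⁻ p, f ((fromRows p.1 p.2).submatrix e.symm id)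
      ∂((Gm K a n).prod (Gm K b n)) := by
    refine Eq.trans (h3.lintegral_comp (f := f) hf).symm ?_
    refine lintegral_congr fun p => ?_
    congr 1
    ext i j
    simp only [Function.comp, MeasurableEquiv.coe_piCongrLeft]
    obtain ⟨i, rfl⟩ := e.surjective i
    rw [Equiv.piCongrLeft_apply_apply]
    rcases i with i | i <;> simp [fromRows] <;> rfl
  rw [h4, lintegral_prod]
  refine (hf.comp ?_).aemeasurable
  refine meas_mat fun i j => ?_
  cases h : e.symm i with
  | inl x => simpa [h] using meas_entry (f := fun p : Matrix a n K × Matrix b n K => p.1) measurable_fst x j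
  | inr x => simpa [h] using meas_entry (f := fun p : Matrix a n K × Matrix b n K => p.2) measurable_snd x j

end measmat

/-! ### Gaussian moments -/
section gaussmom
set_option linter.unusedSectionVars false
variable {K : Type*} [RCLike K] [MeasurableSpace K] [BorelSpace K]
variable {l m n ι a b : Type*} [Fintype l] [Fintype m] [Fintype n] [Fintype ι]
  [DecidableEq l] [DecidableEq m] [DecidableEq n] [DecidableEq ι]
  [Fintype a] [Fintype b] [DecidableEq a] [DecidableEq b]

lemma FR_of_submatrix {Z : Matrix m ι K} {e : ι → m} (h : (Z.submatrix e id).det ≠ 0) : FR Z := by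
  rw [FR_iff]
  intro v hv
  have h1 : (Z.submatrix e id) *ᵥ v = 0 := by
    ext i
    exact congrFun hv (e i)
  by_contra hne
  exact h (Matrix.exists_mulVec_eq_zero_iff.1 ⟨v, hne, h1⟩)

lemma ae_FR_aux (H : Measure (m → ι → K)) [H.IsAddHaarMeasure] (e : ι ↪ m) :
    ∀ᵐ Z ∂H, FR (Matrix.of Z) := by
  let L : ℝ →ₗ[ℝ] (m → ι → K) := LinearMap.toSpanSingleton ℝ _ (Matrix.of.symm (Ec K e))
  have hmeas : MeasurableSet {Z : m → ι → K | FR (Matrix.of Z)} :=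
    meas_FR (meas_mat fun i j => (measurable_pi_apply j).comp (measurable_pi_apply i))
  refine ae_mem_of_ae_add_linearMap_mem (𝕜 := ℝ) (E := ℝ) (F := m → ι → K) L volume H hmeas
    fun Z => ?_
  have hfin : Set.Finite {x : ℝ | ((-((Matrix.of Z).submatrix e id)).charpoly).IsRoot (x : K)} := by
    refine Set.Finite.preimage (RCLike.ofReal_injective.injOn)
      (Polynomial.finite_setOfPred_isRoot (Matrix.charpoly_monic _).ne_zero)
  rw [ae_iff]
  refine measure_mono_null ?_ (hfin.measure_zero _)
  intro x hx
  by_contra hne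
  refine hx (FR_of_submatrix (e := e) fun hdet => hne ?_)
  show Polynomial.eval _ _ = 0
  rw [Matrix.eval_charpoly, ← hdet]
  congr 1
  ext i j
  show (scalar ι (x : K) - -(Matrix.of Z).submatrix e id) i j =
    Z (e i) j + (x • (Ec K e : Matrix m ι K)) (e i) j
  by_cases hij : i = j
  · subst hij
    simp [Ec, RCLike.real_smul_eq_coe_mul, add_comm, Matrix.one_apply]
  · simp [Ec, hij, e.injective.ne hij]

lemma ae_FR (h : Fintype.card ι ≤ Fintype.card m) : ∀ᵐ Z ∂(Gm K m ι), FR Z := by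
  obtain ⟨e⟩ := Function.Embedding.nonempty_of_card_le h
  obtain ⟨-, H, hH, hG⟩ := Gm_isG (K := K) (m := m) (n := ι)
  have hac : Gm K m ι ≪ H := by rw [hG]; exact withDensity_absolutelyContinuous _ _
  refine hac.ae_le ?_
  exact @ae_FR_aux K _ _ _ m ι _ _ _ _ H hH e

lemma Gv_mulVec {W : Matrix m m K} (hW : W ∈ Matrix.unitaryGroup m K) {g : (m → K) → ℝ≥0∞}
    (hg : Measurable g) :
    ∫⁻ x, g (W *ᵥ x) ∂(Measure.pi fun _ : m => gK K) = ∫⁻ x, g x ∂(Measure.pi fun _ => gK K) := by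
  let e : (m → K) ≃+ (m → K) :=
    { toFun := fun x => W *ᵥ x
      invFun := fun x => Wᴴ *ᵥ x
      left_inv := fun x => by
        show Wᴴ *ᵥ (W *ᵥ x) = x
        rw [Matrix.mulVec_mulVec, unitary_left hW, Matrix.one_mulVec]
      right_inv := fun x => by
        show W *ᵥ (Wᴴ *ᵥ x) = x
        rw [Matrix.mulVec_mulVec, unitary_right hW, Matrix.one_mulVec]
      map_add' := fun x y => Matrix.mulVec_add _ _ _ }
  have hc : Continuous e := continuous_const.matrix_mulVec continuous_id
  have hc' : Continuous e.symm := continuous_const.matrix_mulVec continuous_id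
  have hn : ∀ x : m → K, ∑ j, ‖e x j‖ ^ 2 = ∑ j, ‖x j‖ ^ 2 := by
    intro x
    have h1 := frobSq_isom_mul (unitary_left hW) (Matrix.replicateCol Unit x)
    rw [← Matrix.replicateCol_mulVec] at h1
    have h2 : ∀ j, e x j = (W *ᵥ x) j := fun _ => rfl
    simp only [h2]
    simpa [frobSq] using h1
  have hmap : (Measure.pi fun _ : m => gK K).map e = Measure.pi fun _ => gK K :=
    IsG.unique (IsG.map Gv_isG e hc hc' (by fun_prop) hn) Gv_isG
  conv_rhs => rw [← hmap]
  rw [lintegral_map hg hc.measurable]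
  rfl

lemma Gv_second (y : ι → K) :
    ENNReal.ofReal (bK K * ∑ k, ‖y k‖ ^ 2) ≤
      ∫⁻ x, ENNReal.ofReal (‖∑ k, x k * y k‖ ^ 2) ∂(Measure.pi fun _ : ι => gK K) := by
  by_cases hy : ∑ k, ‖y k‖ ^ 2 = 0
  · simp [hy]
  have hpos : 0 < ∑ k, ‖y k‖ ^ 2 :=
    lt_of_le_of_ne (Finset.sum_nonneg fun _ _ => by positivity) (Ne.symm hy)
  set c := Real.sqrt (∑ k, ‖y k‖ ^ 2) with hc
  have hc0 : 0 < c := Real.sqrt_pos.2 hpos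
  have hcc : c ^ 2 = ∑ k, ‖y k‖ ^ 2 := Real.sq_sqrt hpos.le
  obtain ⟨k0, -⟩ : ∃ k0 : ι, True := by
    by_contra hne
    push Not at hne
    have : IsEmpty ι := ⟨fun x => hne x⟩
    simp at hy
  have hcK : (c : K) ≠ 0 := by exact_mod_cast hc0.ne'
  obtain ⟨W, hW, hWe⟩ := ext_unitary (K := K) (fun _ k => star (y k) / (c : K)) {k0} (by
    rintro i rfl j rfl
    simp only [if_true]
    have : ∀ k, star (star (y k) / (c : K)) * (star (y k) / (c : K)) =
        ((‖y k‖ ^ 2 / c ^ 2 : ℝ) : K) := by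
      intro k
      simp only [star_div₀, RCLike.star_def, RCLike.conj_ofReal]
      rw [RCLike.conj_conj, div_mul_div_comm, RCLike.mul_conj]
      push_cast
      rw [sq (c : K)]
    simp only [this]
    rw [← RCLike.ofReal_sum, ← Finset.sum_div, hcc, div_self hy, RCLike.ofReal_one])
  have hWm : Wᴴ ∈ Matrix.unitaryGroup ι K := by
    rw [Matrix.mem_unitaryGroup_iff]
    show Wᴴ * Wᴴᴴ = 1
    rw [conjTranspose_conjTranspose, unitary_left hW]
  have h1 : ∀ x : ι → K, ‖∑ k, x k * y k‖ ^ 2 = c ^ 2 * ‖(Wᴴ *ᵥ x) k0‖ ^ 2 := by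
    intro x
    have : ∑ k, x k * y k = (c : K) * (Wᴴ *ᵥ x) k0 := by
      simp only [Matrix.mulVec, dotProduct, Matrix.conjTranspose_apply, Finset.mul_sum]
      refine Finset.sum_congr rfl fun k _ => ?_
      rw [hWe k0 rfl k]
      simp only [star_div₀, RCLike.star_def, RCLike.conj_ofReal]
      rw [RCLike.conj_conj]
      field_simp
    rw [this, norm_mul, mul_pow, RCLike.norm_ofReal, sq_abs]
  simp only [h1]
  rw [Gv_mulVec hWm (g := fun x => ENNReal.ofReal (c ^ 2 * ‖x k0‖ ^ 2)) (by fun_prop)]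
  rw [(measurePreserving_eval (fun _ : ι => gK K) k0).lintegral_comp
    (f := fun z => ENNReal.ofReal (c ^ 2 * ‖z‖ ^ 2)) (by fun_prop)]
  simp only [ENNReal.ofReal_mul (sq_nonneg c)]
  rw [lintegral_const_mul _ (by fun_prop), ← hcc, ENNReal.ofReal_mul bK_eq.2.1.le, mul_comm]
  gcongr
  exact gK_sq

lemma Gm_row (i : m) {g : (n → K) → ℝ≥0∞} (hg : Measurable g) :
    ∫⁻ A, g (A i) ∂(Gm K m n) = ∫⁻ x, g x ∂(Measure.pi fun _ => gK K) :=
  (measurePreserving_eval (fun _ : m => (Measure.pi fun _ : n => gK K)) i).lintegral_comp hg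

lemma Gm_second (Y : Matrix ι a K) :
    ENNReal.ofReal (Fintype.card b * bK K * frobSq Y) ≤
      ∫⁻ A, ENNReal.ofReal (frobSq (A * Y)) ∂(Gm K b ι) := by
  have h1 : ∀ A : Matrix b ι K, ENNReal.ofReal (frobSq (A * Y)) =
      ∑ i, ∑ j, ENNReal.ofReal (‖∑ k, A i k * Y k j‖ ^ 2) := by
    intro A
    unfold frobSq
    rw [ENNReal.ofReal_sum_of_nonneg fun _ _ => Finset.sum_nonneg fun _ _ => by positivity]
    refine Finset.sum_congr rfl fun i _ => ?_
    rw [ENNReal.ofReal_sum_of_nonneg fun _ _ => by positivity]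
    rfl
  have hm : ∀ i j, Measurable fun A : Matrix b ι K =>
      ENNReal.ofReal (‖∑ k, A i k * Y k j‖ ^ 2) := by
    intro i j
    have : Measurable fun A : Matrix b ι K => ∑ k, A i k * Y k j :=
      Finset.measurable_sum _ fun k _ => (meas_entry measurable_id_mat i k).mul_const _
    fun_prop
  simp only [h1]
  rw [lintegral_finsetSum _ fun i _ => Finset.measurable_sum _ fun j _ => hm i j]
  have h2 : ∀ i : b, ENNReal.ofReal (bK K * frobSq Y) ≤
      ∫⁻ A, ∑ j, ENNReal.ofReal (‖∑ k, A i k * Y k j‖ ^ 2) ∂(Gm K b ι) := by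
    intro i
    rw [lintegral_finsetSum _ fun j _ => hm i j]
    unfold frobSq
    rw [Finset.sum_comm, Finset.mul_sum, ENNReal.ofReal_sum_of_nonneg fun _ _ =>
      mul_nonneg bK_eq.2.1.le (Finset.sum_nonneg fun _ _ => by positivity)]
    refine Finset.sum_le_sum fun j _ => ?_
    rw [Gm_row i (g := fun x => ENNReal.ofReal (‖∑ k, x k * Y k j‖ ^ 2)) (by fun_prop)]
    exact Gv_second _
  calc ENNReal.ofReal (Fintype.card b * bK K * frobSq Y)
      = ∑ i : b, ENNReal.ofReal (bK K * frobSq Y) := by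
        rw [Finset.sum_const, Finset.card_univ, nsmul_eq_mul, mul_assoc,
          ENNReal.ofReal_mul (by positivity), ENNReal.ofReal_natCast]
    _ ≤ _ := Finset.sum_le_sum fun i _ => h2 i

end gaussmom

/-! ### Gaussian inverse moment -/
section gaussinv
set_option linter.unusedSectionVars false
variable {K : Type*} [RCLike K] [MeasurableSpace K] [BorelSpace K]
variable {l m n ι a b : Type*} [Fintype l] [Fintype m] [Fintype n] [Fintype ι]
  [DecidableEq l] [DecidableEq m] [DecidableEq n] [DecidableEq ι]
  [Fintype a] [Fintype b] [DecidableEq a] [DecidableEq b]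

lemma unitary_conj {W : Matrix m m K} (hW : W ∈ Matrix.unitaryGroup m K) :
    Wᴴ ∈ Matrix.unitaryGroup m K := by
  rw [Matrix.mem_unitaryGroup_iff]
  show Wᴴ * Wᴴᴴ = 1
  rw [conjTranspose_conjTranspose, unitary_left hW]

lemma vec_cs (s : Finset a) (u x : a → K) (h : ∑ j, u j * x j = 1) (hu : ∀ j ∉ s, u j = 0) :
    1 ≤ (∑ j, ‖u j‖ ^ 2) * ∑ j ∈ s, ‖x j‖ ^ 2 := by
  have h1 : ∑ j ∈ s, u j * x j = 1 := by
    rw [← h]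
    exact Finset.sum_subset (Finset.subset_univ s) fun j _ hj => by rw [hu j hj, zero_mul]
  have h2 : (1 : ℝ) ≤ ∑ j ∈ s, ‖u j‖ * ‖x j‖ := by
    calc (1 : ℝ) = ‖∑ j ∈ s, u j * x j‖ := by rw [h1, norm_one]
      _ ≤ ∑ j ∈ s, ‖u j * x j‖ := norm_sum_le _ _
      _ = _ := by simp only [norm_mul]
  calc (1 : ℝ) ≤ (∑ j ∈ s, ‖u j‖ * ‖x j‖) ^ 2 := by nlinarith
    _ ≤ (∑ j ∈ s, ‖u j‖ ^ 2) * ∑ j ∈ s, ‖x j‖ ^ 2 := Finset.sum_mul_sq_le_sq_mul_sq _ _ _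
    _ ≤ _ := by
      refine mul_le_mul_of_nonneg_right ?_ (Finset.sum_nonneg fun _ _ => by positivity)
      exact Finset.sum_le_sum_of_subset_of_nonneg (Finset.subset_univ s) fun _ _ _ => by positivity

/-- Conditional bound: one random column `x`, the other columns `A'` fixed. -/
lemma inv_col (hc : Fintype.card ι ≤ Fintype.card a + 1) (A' : Matrix a l K)
    (hl : Fintype.card l + 1 = Fintype.card ι)
    (hp : 1 < bK K * ((Fintype.card a : ℝ) - Fintype.card ι + 1))
    {g : (a → K) → ℝ≥0∞}
    (hg : ∀ x, g x = ∞ ∨ FR A' ∧ ∃ y : a → K, ∑ j, y j * x j = 1 ∧ (∀ i, ∑ j, y j * A' j i = 0) ∧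
      ENNReal.ofReal (∑ j, ‖y j‖ ^ 2) ≤ g x) :
    ENNReal.ofReal (1 / (bK K * ((Fintype.card a : ℝ) - Fintype.card ι + 1) - 1)) ≤
      ∫⁻ x, g x ∂(Measure.pi fun _ : a => gK K) := by
  by_cases hA : FR A'
  swap
  · have : ∀ x, g x = ∞ := fun x => (hg x).resolve_right fun h => hA h.1
    simp [this]
  have hcl : Fintype.card l ≤ Fintype.card a := by omega
  obtain ⟨e⟩ := Function.Embedding.nonempty_of_card_le hcl
  obtain ⟨W, hW, R, hR, hWR⟩ := exists_unitary_factor hA e.injective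
  set s : Finset a := (Finset.univ.map e)ᶜ with hs
  have hcard : (s.card : ℝ) = (Fintype.card a : ℝ) - Fintype.card ι + 1 := by
    have : s.card + Fintype.card ι = Fintype.card a + 1 := by
      rw [hs, Finset.card_compl, Finset.card_map, Finset.card_univ]; omega
    have : (s.card : ℝ) + Fintype.card ι = Fintype.card a + 1 := by exact_mod_cast this
    linarith
  rw [← hcard] at hp ⊢
  refine (gK_inv_vec s hp).trans ?_
  rw [← Gv_mulVec (unitary_conj hW)
    (g := fun x => (ENNReal.ofReal (∑ i ∈ s, ‖x i‖ ^ 2))⁻¹) (by fun_prop)]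
  refine lintegral_mono fun x => ?_
  rcases hg x with h | ⟨-, y, hy1, hy2, hy3⟩
  · rw [h]; exact le_top
  refine le_trans ?_ hy3
  -- rotate
  set u : a → K := y ᵥ* W with hu
  have hn : ∑ j, ‖u j‖ ^ 2 = ∑ j, ‖y j‖ ^ 2 := by
    have h1 := frobSq_mul_coisom (unitary_right hW) (Matrix.replicateRow Unit y)
    rw [← Matrix.replicateRow_vecMul] at h1
    simpa [frobSq] using h1
  have h1 : ∑ j, u j * (Wᴴ *ᵥ x) j = 1 := by
    have : u ⬝ᵥ (Wᴴ *ᵥ x) = y ⬝ᵥ x := by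
      rw [hu, Matrix.dotProduct_mulVec, Matrix.vecMul_vecMul, unitary_right hW, Matrix.vecMul_one]
    exact this.trans hy1
  have h2 : ∀ j ∉ s, u j = 0 := by
    intro j hj
    simp only [hs, Finset.mem_compl, Finset.mem_map, Finset.mem_univ, true_and, not_not] at hj
    obtain ⟨i, rfl⟩ := hj
    have h3 : y ᵥ* A' = 0 := funext fun i => hy2 i
    have h4 : y ᵥ* (W * Ec K e) = 0 := by
      have : W * Ec K e = A' * R⁻¹ := by
        rw [hWR, Matrix.mul_assoc _ R, Matrix.mul_nonsing_inv _ hR, Matrix.mul_one]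
      rw [this, ← Matrix.vecMul_vecMul, h3, Matrix.zero_vecMul]
    have := congrFun h4 i
    rwa [mul_Ec] at this
  have h5 := vec_cs s u _ h1 h2
  rw [hn] at h5
  have h6 : 0 < ∑ j ∈ s, ‖(Wᴴ *ᵥ x) j‖ ^ 2 := by
    by_contra hneg
    have h7 : ∑ j ∈ s, ‖(Wᴴ *ᵥ x) j‖ ^ 2 = 0 :=
      le_antisymm (not_lt.1 hneg) (Finset.sum_nonneg fun _ _ => by positivity)
    rw [h7] at h5; linarith
  rw [← ENNReal.ofReal_inv_of_pos h6]
  apply ENNReal.ofReal_le_ofReal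
  rw [inv_le_iff_one_le_mul₀ h6]
  exact h5

lemma inv_row (hp : 1 < bK K * ((Fintype.card a : ℝ) - Fintype.card ι + 1)) (i : ι)
    {f : Matrix a ι K → ℝ≥0∞} (hf : Measurable f)
    (h : ∀ Z, f Z = ∞ ∨ ∃ Y : Matrix ι a K, Y * Z = 1 ∧ ENNReal.ofReal (∑ j, ‖Y i j‖ ^ 2) ≤ f Z) :
    ENNReal.ofReal (1 / (bK K * ((Fintype.card a : ℝ) - Fintype.card ι + 1) - 1)) ≤
      ∫⁻ Z, f Z ∂(Gm K a ι) := by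
  have hc : Fintype.card ι ≤ Fintype.card a + 1 := by
    by_contra hlt
    have h1 : (Fintype.card a : ℝ) + 1 < Fintype.card ι := by exact_mod_cast not_le.1 hlt
    nlinarith [bK_eq (K := K)]
  have hT : Measurable fun A : Matrix ι a K => Aᵀ :=
    meas_mat fun i j => meas_entry measurable_id_mat j i
  rw [← lint_transpose hf, lint_split (Equiv.sumCompl (fun j => j ≠ i)) (f := fun A => f Aᵀ)
    (hf.comp hT)]
  refine le_trans (by simp) (lintegral_mono (μ := Gm K {j // j ≠ i} a) (f := fun _ =>
    ENNReal.ofReal (1 / (bK K * ((Fintype.card a : ℝ) - Fintype.card ι + 1) - 1))) fun A => ?_)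
  let i0 : {j // ¬ j ≠ i} := ⟨i, by simp⟩
  let g : (a → K) → ℝ≥0∞ := fun x => f (Matrix.of fun r c => if hc : c ≠ i then A ⟨c, hc⟩ r else x r)
  have hgm : Measurable g := by
    refine hf.comp (meas_mat fun r c => ?_)
    by_cases hc : c ≠ i
    · simp [hc]
    · simp only [Matrix.of_apply, hc, dite_false]; fun_prop
  have h1 : ∀ B : Matrix {j // ¬ j ≠ i} a K,
      f ((fromRows A B).submatrix (Equiv.sumCompl (fun j => j ≠ i)).symm id)ᵀ =
        g (B i0) := by
    intro B
    congr 1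
    ext r c
    by_cases hc : c ≠ i
    · rw [Matrix.transpose_apply, Matrix.submatrix_apply, Equiv.sumCompl_symm_apply_of_pos (p := fun j => j ≠ i) hc]
      simp only [Matrix.of_apply, hc, dite_true, ne_eq, not_false_eq_true]
      rfl
    · have : (⟨c, hc⟩ : {j // ¬ j ≠ i}) = i0 := Subtype.ext (not_not.1 hc)
      rw [Matrix.transpose_apply, Matrix.submatrix_apply, Equiv.sumCompl_symm_apply_of_neg (p := fun j => j ≠ i) hc]
      simp only [Matrix.of_apply, hc, dite_false]
      rw [← this]; rfl
  simp only [h1]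
  rw [Gm_row i0 hgm]
  refine inv_col hc Aᵀ ?_ hp fun x => ?_
  · rw [Fintype.card_subtype_compl]; simp
    exact Nat.sub_add_cancel (Fintype.card_pos_iff.2 ⟨i⟩)
  rcases h (Matrix.of fun r c => if hc : c ≠ i then A ⟨c, hc⟩ r else x r) with h | ⟨Y, hY, hYf⟩
  · exact Or.inl h
  right
  refine ⟨?_, Y i, ?_, ?_, hYf⟩
  · refine FR_of_left_inv (Y := Y.submatrix (fun j : {j // j ≠ i} => j.1) id) ?_
    ext p s
    have := congrFun (congrFun hY p.1) s.1
    rw [Matrix.mul_apply] at this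
    simp only [Matrix.of_apply, dif_pos s.2] at this
    rw [Matrix.mul_apply]
    simpa [Matrix.one_apply, Subtype.ext_iff] using this
  · have := congrFun (congrFun hY i) i
    rw [Matrix.mul_apply] at this
    simpa using this
  · intro s
    have := congrFun (congrFun hY i) s.1
    rw [Matrix.mul_apply] at this
    simp only [Matrix.of_apply, dif_pos s.2, Matrix.one_apply_ne s.2.symm] at this
    simpa using this

lemma gauss_main (Y : Matrix a ι K → Matrix ι a K) (hYm : Measurable Y)
    (hY : ∀ᵐ Z ∂(Gm K a ι), Y Z * Z = 1)
    (hc : (Fintype.card ι : ℝ) + alphaK K < Fintype.card a) :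
    ENNReal.ofReal (Fintype.card b * (Fintype.card ι /
      ((Fintype.card a : ℝ) - Fintype.card ι - alphaK K))) ≤
      ∫⁻ Z, ∫⁻ Z', ENNReal.ofReal (frobSq (Z' * Y Z)) ∂(Gm K b ι) ∂(Gm K a ι) := by
  classical
  obtain ⟨hb, hb0, hb1⟩ := bK_eq (K := K)
  set p : ℝ := (Fintype.card a : ℝ) - Fintype.card ι + 1 with hpdef
  have hp : 1 < bK K * p := by
    rw [← hb]
    exact mul_lt_mul_of_pos_left (by rw [hpdef]; linarith) hb0
  refine le_trans ?_ (lintegral_mono fun Z => Gm_second (Y Z))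
  have e1 : ∀ Z, ENNReal.ofReal (Fintype.card b * bK K * frobSq (Y Z)) =
      ENNReal.ofReal (Fintype.card b * bK K) * ∑ i, ENNReal.ofReal (∑ j, ‖Y Z i j‖ ^ 2) := by
    intro Z
    rw [ENNReal.ofReal_mul (by positivity)]
    unfold frobSq
    rw [ENNReal.ofReal_sum_of_nonneg fun _ _ => Finset.sum_nonneg fun _ _ => by positivity]
  have hm : ∀ i, Measurable fun Z : Matrix a ι K => ENNReal.ofReal (∑ j, ‖Y Z i j‖ ^ 2) := fun i =>
    (Finset.measurable_sum _ fun j _ => ((meas_entry hYm i j).norm).pow_const 2).ennreal_ofReal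
  simp only [e1]
  rw [lintegral_const_mul _ (Finset.measurable_sum _ fun i _ => hm i),
    lintegral_finsetSum _ fun i _ => hm i]
  have hS : MeasurableSet {Z : Matrix a ι K | Y Z * Z = 1} :=
    (meas_mul hYm measurable_id_mat) (measurableSet_singleton (1 : Matrix ι ι K))
  have h1 : ∀ i : ι, ENNReal.ofReal (1 / (bK K * p - 1)) ≤
      ∫⁻ Z, ENNReal.ofReal (∑ j, ‖Y Z i j‖ ^ 2) ∂(Gm K a ι) := by
    intro i
    have h2 : ∫⁻ Z, ENNReal.ofReal (∑ j, ‖Y Z i j‖ ^ 2) ∂(Gm K a ι) =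
        ∫⁻ Z, (if Y Z * Z = 1 then ENNReal.ofReal (∑ j, ‖Y Z i j‖ ^ 2) else ∞) ∂(Gm K a ι) := by
      refine lintegral_congr_ae ?_
      filter_upwards [hY] with Z hZ
      rw [if_pos hZ]
    rw [h2]
    refine inv_row hp i (Measurable.ite hS (hm i) measurable_const) fun Z => ?_
    by_cases hZ : Y Z * Z = 1
    · right; exact ⟨Y Z, hZ, by rw [if_pos hZ]⟩
    · left; rw [if_neg hZ]
  calc _ = ENNReal.ofReal (Fintype.card b * bK K) *
        ∑ i : ι, ENNReal.ofReal (1 / (bK K * p - 1)) := by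
        rw [Finset.sum_const, Finset.card_univ, nsmul_eq_mul, ← ENNReal.ofReal_natCast,
          ← ENNReal.ofReal_mul (by positivity), ← ENNReal.ofReal_mul (by positivity)]
        congr 1
        have e2 : bK K * p - 1 = bK K * ((Fintype.card a : ℝ) - Fintype.card ι - alphaK K) := by
          rw [hpdef]; linear_combination hb
        have e3 : (Fintype.card a : ℝ) - Fintype.card ι - alphaK K ≠ 0 := by
          intro h0; linarith
        rw [e2]
        field_simp
    _ ≤ _ := by
        gcongr with i
        exact h1 i

end gaussinv

/-! ### Haar measure on the unitary group, as a measure on matrices -/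
section haaru
set_option linter.unusedSectionVars false
variable {K : Type*} [RCLike K] [MeasurableSpace K] [BorelSpace K]
variable {l m n ι a b : Type*} [Fintype l] [Fintype m] [Fintype n] [Fintype ι]
  [DecidableEq l] [DecidableEq m] [DecidableEq n] [DecidableEq ι]
  [Fintype a] [Fintype b] [DecidableEq a] [DecidableEq b]

lemma exists_haar (K : Type*) [RCLike K] [MeasurableSpace K] [BorelSpace K]
    (m : Type*) [Fintype m] [DecidableEq m] :
    ∃ P : Measure (Matrix m m K), IsProbabilityMeasure P ∧
      (∀ᵐ U ∂P, U ∈ Matrix.unitaryGroup m K) ∧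
      ∀ V ∈ Matrix.unitaryGroup m K, P.map (fun U => U * V) = P := by
  have hclosed : IsClosed ((Matrix.unitaryGroup m K : Set (Matrix m m K))) := by
    have : (Matrix.unitaryGroup m K : Set (Matrix m m K)) = {U | U * Uᴴ = 1} := by
      ext U; exact Matrix.mem_unitaryGroup_iff
    rw [this]
    exact isClosed_eq (continuous_id.matrix_mul continuous_id.matrix_conjTranspose)
      continuous_const
  have hcompact : IsCompact ((Matrix.unitaryGroup m K : Set (Matrix m m K))) := by
    have hb : IsCompact (Set.pi Set.univ fun _ : m => Set.pi Set.univ fun _ : m =>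
        Metric.closedBall (0 : K) 1) :=
      isCompact_univ_pi fun _ => isCompact_univ_pi fun _ => isCompact_closedBall _ _
    refine IsCompact.of_isClosed_subset (X := Matrix m m K) hb hclosed ?_
    intro U hU i _ j _
    simpa using entry_norm_bound_of_unitary hU i j
  have : CompactSpace (Matrix.unitaryGroup m K) := isCompact_iff_compactSpace.1 hcompact
  let : MeasurableSpace (Matrix.unitaryGroup m K) := Subtype.instMeasurableSpace
  have : BorelSpace (Matrix.unitaryGroup m K) := Subtype.borelSpace _
  have : SecondCountableTopology (Matrix.unitaryGroup m K) :=
    TopologicalSpace.Subtype.secondCountableTopology (Matrix.unitaryGroup m K : Set (Matrix m m K))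
  let H0 : Measure (Matrix.unitaryGroup m K) := Measure.haarMeasure ⊤
  have : IsProbabilityMeasure H0 := ⟨Measure.haarMeasure_self⟩
  let H1 := H0.inv
  have : IsProbabilityMeasure H1 :=
    Measure.isProbabilityMeasure_map measurable_inv.aemeasurable
  have hco : Measurable (fun U : Matrix.unitaryGroup m K => (U : Matrix m m K)) :=
    measurable_subtype_coe
  refine ⟨H1.map (fun U : Matrix.unitaryGroup m K => (U : Matrix m m K)),
    Measure.isProbabilityMeasure_map hco.aemeasurable, ?_, ?_⟩
  · refine (ae_map_iff (p := fun U => U ∈ Matrix.unitaryGroup m K) hco.aemeasurable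
      hclosed.measurableSet).2 ?_
    exact Eventually.of_forall fun U => U.2
  · intro V hV
    rw [Measure.map_map (meas_mul measurable_id_mat measurable_const) hco]
    have h1 : H1.map (fun U => U * (⟨V, hV⟩ : Matrix.unitaryGroup m K)) = H1 :=
      map_mul_right_eq_self _ _
    conv_rhs => rw [← h1]
    rw [Measure.map_map hco (measurable_mul_const _)]
    rfl

/-- Right-invariant probability measure on unitary matrices. -/
def Hu (K : Type*) [RCLike K] [MeasurableSpace K] [BorelSpace K]
    (m : Type*) [Fintype m] [DecidableEq m] : Measure (Matrix m m K) := (exists_haar K m).choose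

instance : IsProbabilityMeasure (Hu K m) := (exists_haar K m).choose_spec.1

lemma Hu_ae : ∀ᵐ U ∂(Hu K m), U ∈ Matrix.unitaryGroup m K := (exists_haar K m).choose_spec.2.1

lemma Hu_right {V : Matrix m m K} (hV : V ∈ Matrix.unitaryGroup m K) {f : Matrix m m K → ℝ≥0∞}
    (hf : Measurable f) : ∫⁻ U, f (U * V) ∂(Hu K m) = ∫⁻ U, f U ∂(Hu K m) := by
  have h1 : (Hu K m).map (fun U => U * V) = Hu K m := (exists_haar K m).choose_spec.2.2 V hV
  conv_rhs => rw [← h1]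
  rw [lintegral_map hf (meas_mul measurable_id_mat measurable_const)]

/-- The distribution of the range of `U * M` is that of the range of a Gaussian matrix. -/
lemma Hu_gauss {f : Matrix m ι K → ℝ≥0∞} (hf : Measurable f)
    (hfT : ∀ (Z : Matrix m ι K) (T : Matrix ι ι K), IsUnit T.det → f (Z * T) = f Z)
    {M : Matrix m ι K} (hM : FR M) :
    ∫⁻ U, f (U * M) ∂(Hu K m) = ∫⁻ Z, f Z ∂(Gm K m ι) := by
  have hcard : Fintype.card ι ≤ Fintype.card m := by
    have h1 : LinearIndependent K M.col := by
      rw [← Matrix.mulVec_injective_iff, ← Matrix.coe_mulVecLin, ← LinearMap.ker_eq_bot,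
        LinearMap.ker_eq_bot']
      exact (FR_iff M).1 hM
    simpa using h1.fintype_card_le_finrank
  obtain ⟨e⟩ := Function.Embedding.nonempty_of_card_le hcard
  have hfm : ∀ N : Matrix m ι K, Measurable fun U : Matrix m m K => f (U * N) := fun N =>
    hf.comp (meas_mul measurable_id_mat measurable_const)
  have key : ∀ N : Matrix m ι K, FR N →
      ∫⁻ U, f (U * N) ∂(Hu K m) = ∫⁻ U, f (U * Ec K e) ∂(Hu K m) := by
    intro N hN
    obtain ⟨W, hW, R, hR, h⟩ := exists_unitary_factor hN e.injective
    rw [h]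
    simp only [← Matrix.mul_assoc, hfT _ R hR]
    exact Hu_right hW (f := fun U => f (U * Ec K e)) (hfm _)
  rw [key M hM]
  have h1 : ∫⁻ Z, ∫⁻ U, f (U * Z) ∂(Hu K m) ∂(Gm K m ι) = ∫⁻ U, f (U * Ec K e) ∂(Hu K m) := by
    have : ∀ᵐ Z ∂(Gm K m ι), ∫⁻ U, f (U * Z) ∂(Hu K m) = ∫⁻ U, f (U * Ec K e) ∂(Hu K m) := by
      filter_upwards [ae_FR (K := K) hcard] with Z hZ using key Z hZ
    rw [lintegral_congr_ae this]
    simp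
  rw [← h1, lintegral_lintegral_swap (f := fun (Z : Matrix m ι K) (U : Matrix m m K) => f (U * Z))
    (hf.comp (meas_mul (f := fun p : Matrix m ι K × Matrix m m K => p.2) (g := fun p => p.1)
      measurable_snd measurable_fst)).aemeasurable]
  have : ∀ᵐ U ∂(Hu K m), ∫⁻ Z, f (U * Z) ∂(Gm K m ι) = ∫⁻ Z, f Z ∂(Gm K m ι) := by
    filter_upwards [Hu_ae (K := K) (m := m)] with U hU using lint_mul hU hf
  rw [lintegral_congr_ae this]
  simp

end haaru

/-! ### First step: averaging over the left rotation -/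
section stepone
set_option linter.unusedSectionVars false
variable {K : Type*} [RCLike K] [MeasurableSpace K] [BorelSpace K]
variable {d n ι κ b c : Type*} [Fintype d] [Fintype n] [Fintype ι] [Fintype κ]
  [DecidableEq d] [DecidableEq n] [DecidableEq ι] [DecidableEq κ]
  [Fintype b] [DecidableEq b] [Fintype c] [DecidableEq c]

/-- The left inverse of `Z` built from the sketch `Ψ`. -/
def yy (Ψ : Matrix d κ K) (Z : Matrix d ι K) : Matrix ι d K := linv (Ψᴴ * Z) * Ψᴴ

lemma yy_mul {Ψ : Matrix d κ K} {Z : Matrix d ι K} (h : FR (Ψᴴ * Z)) : yy Ψ Z * Z = 1 := by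
  rw [yy, Matrix.mul_assoc, linv_mul h]

lemma yy_mul_unit (Ψ : Matrix d κ K) (Z : Matrix d ι K) {T : Matrix ι ι K} (hT : IsUnit T.det) :
    yy Ψ (Z * T) = T⁻¹ * yy Ψ Z := by
  rw [yy, ← Matrix.mul_assoc, linv_mul_unit _ hT, Matrix.mul_assoc]; rfl

lemma mul_yy_mul_unit (Ψ : Matrix d κ K) (Z : Matrix d ι K) {T : Matrix ι ι K}
    (hT : IsUnit T.det) : Z * T * yy Ψ (Z * T) = Z * yy Ψ Z := by
  rw [yy_mul_unit _ _ hT, Matrix.mul_assoc, Matrix.mul_nonsing_inv_cancel_left _ _ hT]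

variable {X : Type*} [MeasurableSpace X]

lemma meas_yy {f : X → Matrix d κ K} {g : X → Matrix d ι K} (hf : Measurable f)
    (hg : Measurable g) : Measurable fun x => yy (f x) (g x) :=
  meas_mul (meas_linv (meas_mul (meas_conjT hf) hg)) (meas_conjT hf)

lemma FR_isom_mul {W : Matrix d n K} (hW : Wᴴ * W = 1) {Z : Matrix n ι K} :
    FR (W * Z) ↔ FR Z := by
  unfold FR
  rw [conjTranspose_mul, Matrix.mul_assoc, ← Matrix.mul_assoc Wᴴ, hW, Matrix.one_mul]

lemma FR_mul_right_unit {Z : Matrix d ι K} {T : Matrix ι ι K} (hT : IsUnit T.det) :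
    FR (Z * T) ↔ FR Z := by
  constructor
  · intro h
    have := FR_mul h (FR_unit (T := T⁻¹) (by rw [Matrix.det_nonsing_inv]; simpa using hT))
    rwa [Matrix.mul_assoc, Matrix.mul_nonsing_inv _ hT, Matrix.mul_one] at this
  · intro h
    exact FR_mul h (FR_unit hT)

lemma Ec_split (e : κ ⊕ b ≃ d) (A : Matrix κ n K) (B : Matrix b n K) :
    (Ec K (e ∘ Sum.inl))ᴴ * ((fromRows A B).submatrix e.symm id) = A := by
  rw [Ec_conj_mul]
  ext i j
  simp

lemma frobSq_split (e : κ ⊕ b ≃ d) (A : Matrix κ n K) (B : Matrix b n K) :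
    frobSq ((fromRows A B).submatrix e.symm id) = frobSq A + frobSq B := by
  unfold frobSq
  rw [← e.sum_comp, Fintype.sum_sum_type]
  simp

lemma split_mul (e : κ ⊕ b ≃ d) (A : Matrix κ n K) (B : Matrix b n K) (C : Matrix n c K) :
    ((fromRows A B).submatrix e.symm id) * C = (fromRows (A * C) (B * C)).submatrix e.symm id := by
  rw [← Matrix.fromRows_mul]
  ext i j
  rfl

lemma e_inl_inj (e : κ ⊕ b ≃ d) : Function.Injective (e ∘ Sum.inl) :=
  e.injective.comp Sum.inl_injective

lemma lint_mul_split (e : κ ⊕ b ≃ d) {W : Matrix d d K} (hW : W ∈ Matrix.unitaryGroup d K)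
    {f : Matrix d n K → ℝ≥0∞} (hf : Measurable f) :
    ∫⁻ A, f A ∂(Gm K d n) = ∫⁻ A, ∫⁻ B, f (W * (fromRows A B).submatrix e.symm id)
      ∂(Gm K b n) ∂(Gm K κ n) := by
  rw [← lint_mul hW hf]
  exact lint_split e (f := fun A => f (W * A)) (hf.comp (meas_mul measurable_const measurable_id_mat))

lemma Hu_gauss_ae {p : Matrix d ι K → Prop} (hp : MeasurableSet {Z | p Z})
    (hpT : ∀ (Z : Matrix d ι K) (T : Matrix ι ι K), IsUnit T.det → (p (Z * T) ↔ p Z))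
    {M : Matrix d ι K} (hM : FR M) (h : ∀ᵐ Z ∂(Gm K d ι), p Z) : ∀ᵐ U ∂(Hu K d), p (U * M) := by
  classical
  have hf : Measurable fun Z : Matrix d ι K => if p Z then (0 : ℝ≥0∞) else 1 :=
    Measurable.ite hp measurable_const measurable_const
  have h1 := Hu_gauss hf (fun Z T hT => by simp only [hpT Z T hT]) hM
  have h2 : ∫⁻ Z, (if p Z then (0 : ℝ≥0∞) else 1) ∂(Gm K d ι) = 0 := by
    rw [lintegral_eq_zero_iff hf]
    filter_upwards [h] with Z hZ
    simp [hZ]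
  rw [h2, lintegral_eq_zero_iff (f := fun U : Matrix d d K => if p (U * M) then (0 : ℝ≥0∞) else 1)
    (hf.comp (meas_mul measurable_id_mat measurable_const))] at h1
  filter_upwards [h1] with U hU
  by_contra hne
  simp [hne] at hU

lemma ae_FR_sketch_gauss (e : κ ⊕ b ≃ d) {Ψ : Matrix d κ K} (hΨ : FR Ψ)
    (hc : Fintype.card ι ≤ Fintype.card κ) : ∀ᵐ Z ∂(Gm K d ι), FR (Ψᴴ * Z) := by
  classical
  obtain ⟨W, hW, R, hR, h⟩ := exists_unitary_factor hΨ (e_inl_inj e)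
  have hR' : IsUnit (Rᴴ).det := by rw [det_conjTranspose]; exact hR.star
  have hS : MeasurableSet {Z : Matrix d ι K | FR (Ψᴴ * Z)}ᶜ :=
    (meas_FR (meas_mul measurable_const measurable_id_mat)).compl
  have h0 : ∫⁻ Z, ({Z : Matrix d ι K | FR (Ψᴴ * Z)}ᶜ).indicator 1 Z ∂(Gm K d ι) = 0 := by
    rw [lint_mul_split e hW (measurable_one.indicator hS)]
    have : ∀ᵐ A ∂(Gm K κ ι), ∫⁻ B, ({Z : Matrix d ι K | FR (Ψᴴ * Z)}ᶜ).indicator 1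
        (W * ((fromRows A B).submatrix e.symm id)) ∂(Gm K b ι) = (0 : ℝ≥0∞) := by
      filter_upwards [ae_FR (K := K) hc] with A hA
      have : ∀ B : Matrix b ι K, ({Z : Matrix d ι K | FR (Ψᴴ * Z)}ᶜ).indicator 1
        (W * ((fromRows A B).submatrix e.symm id)) = (0 : ℝ≥0∞) := by
        intro B
        refine Set.indicator_of_notMem ?_ _
        simp only [Set.mem_compl_iff, Set.mem_ofPred_eq, not_not]
        rw [h, conjTranspose_mul, conjTranspose_mul, Matrix.mul_assoc, Matrix.mul_assoc,
          ← Matrix.mul_assoc Wᴴ, unitary_left hW, Matrix.one_mul, Ec_split]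
        exact FR_mul (FR_unit hR') hA
      simp [this]
    rw [lintegral_congr_ae this]
    simp
  rw [lintegral_indicator_one hS] at h0
  exact h0

lemma ae_FR_sketch (e : κ ⊕ b ≃ d) {Ψ : Matrix d κ K} (hΨ : FR Ψ)
    (hc : Fintype.card ι ≤ Fintype.card κ) {M : Matrix d ι K} (hM : FR M) :
    ∀ᵐ U ∂(Hu K d), FR (Ψᴴ * (U * M)) := by
  refine Hu_gauss_ae (p := fun Z => FR (Ψᴴ * Z))
    (meas_FR (meas_mul measurable_const measurable_id_mat)) (fun Z T hT => ?_) hM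
    (ae_FR_sketch_gauss e hΨ hc)
  rw [← Matrix.mul_assoc, FR_mul_right_unit hT]

/-- The functional whose Gaussian average gives the first factor. -/
def FF (Ψ : Matrix d κ K) (Z : Matrix d ι K) : ℝ≥0∞ :=
  ENNReal.ofReal (frobSq (Z * yy Ψ Z * (1 - prj Z)))

lemma meas_FF (Ψ : Matrix d κ K) : Measurable (FF (ι := ι) Ψ) :=
  meas_oF (meas_mul (meas_mul measurable_id_mat (meas_yy measurable_const measurable_id_mat))
    (meas_sub measurable_const (meas_prj measurable_id_mat)))

lemma FF_gauss (e : κ ⊕ b ≃ d) {Ψ : Matrix d κ K} (hΨ : FR Ψ)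
    (hc : (Fintype.card ι : ℝ) + alphaK K < Fintype.card κ) :
    ENNReal.ofReal (Fintype.card b * (Fintype.card ι /
      ((Fintype.card κ : ℝ) - Fintype.card ι - alphaK K))) ≤ ∫⁻ Z, FF Ψ Z ∂(Gm K d ι) := by
  obtain ⟨W, hW, R, hR, h⟩ := exists_unitary_factor hΨ (e_inl_inj e)
  have hR' : IsUnit (Rᴴ).det := by rw [det_conjTranspose]; exact hR.star
  have hα : 0 ≤ alphaK K := by unfold alphaK; split_ifs <;> norm_num
  have hc' : Fintype.card ι ≤ Fintype.card κ := by
    have : (Fintype.card ι : ℝ) ≤ Fintype.card κ := by linarith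
    exact_mod_cast this
  rw [lint_mul_split e hW (meas_FF Ψ)]
  set Y : Matrix κ ι K → Matrix ι κ K := fun A => linv (Rᴴ * A) * Rᴴ with hYdef
  have hY : ∀ A, FR A → Y A * A = 1 := fun A hA => by
    rw [hYdef]
    simp only
    rw [Matrix.mul_assoc, linv_mul (FR_mul (FR_unit hR') hA)]
  refine (gauss_main (b := b) Y (meas_mul (meas_linv (meas_mul measurable_const measurable_id_mat))
    measurable_const) ((ae_FR hc').mono hY) hc).trans ?_
  refine lintegral_mono_ae ?_
  filter_upwards [ae_FR (K := K) hc'] with A hA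
  refine lintegral_mono fun B => ?_
  set Z := (fromRows A B).submatrix e.symm id with hZ
  set E := Ec K (e ∘ Sum.inl) with hE
  have hEE : Eᴴ * E = 1 := Ec_isom (e_inl_inj e)
  have hΨZ : Ψᴴ * (W * Z) = Rᴴ * A := by
    rw [h, conjTranspose_mul, conjTranspose_mul, Matrix.mul_assoc, Matrix.mul_assoc,
          ← Matrix.mul_assoc Wᴴ, unitary_left hW, Matrix.one_mul, Ec_split]
  have hyy : yy Ψ (W * Z) = Y A * Eᴴ * Wᴴ := by
    rw [yy, hΨZ, h, conjTranspose_mul, conjTranspose_mul, hYdef]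
    simp only [Matrix.mul_assoc]
  have hYZ : (Y A * Eᴴ) * Z = 1 := by
    rw [Matrix.mul_assoc, hZ, Ec_split, hY A hA]
  have h1 : FF Ψ (W * Z) = ENNReal.ofReal (frobSq (Z * (Y A * Eᴴ) * (1 - prj Z))) := by
    unfold FF
    congr 1
    rw [hyy, prj_isom_mul (unitary_left hW)]
    have : W * Z * (Y A * Eᴴ * Wᴴ) * (1 - W * prj Z * Wᴴ) =
        W * ((Z * (Y A * Eᴴ) * (1 - prj Z)) * Wᴴ) := by
      have e1 : Wᴴ * (1 - W * prj Z * Wᴴ) = (1 - prj Z) * Wᴴ := by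
        rw [Matrix.mul_sub, Matrix.sub_mul, ← Matrix.mul_assoc, ← Matrix.mul_assoc,
          unitary_left hW, Matrix.one_mul, Matrix.one_mul, Matrix.mul_one]
      have e2 : W * Z * (Y A * Eᴴ * Wᴴ) * (1 - W * prj Z * Wᴴ) =
        W * (Z * (Y A * Eᴴ)) * (Wᴴ * (1 - W * prj Z * Wᴴ)) := by simp only [Matrix.mul_assoc]
      rw [e2, e1]
      simp only [Matrix.mul_assoc]
    rw [this, frobSq_isom_mul (unitary_left hW),
      frobSq_mul_coisom (by rw [conjTranspose_conjTranspose]; exact unitary_left hW)]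
  show _ ≤ FF Ψ (W * Z)
  rw [h1]
  apply ENNReal.ofReal_le_ofReal
  have h2 := frobSq_oblique hYZ
  have h3 : frobSq (Z * (Y A * Eᴴ)) = frobSq (A * Y A) + frobSq (B * Y A) := by
    rw [← Matrix.mul_assoc, frobSq_mul_coisom (by rw [conjTranspose_conjTranspose]; exact hEE),
      hZ, split_mul, frobSq_split]
  have h4 := card_le_frobSq_oblique (hY A hA)
  linarith

end stepone

section steponeb
set_option linter.unusedSectionVars false
variable {K : Type*} [RCLike K] [MeasurableSpace K] [BorelSpace K]
variable {d n ι κ b c : Type*} [Fintype d] [Fintype n] [Fintype ι] [Fintype κ]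
  [DecidableEq d] [DecidableEq n] [DecidableEq ι] [DecidableEq κ]
  [Fintype b] [DecidableEq b] [Fintype c] [DecidableEq c]

/-- Squared norm of a vector. -/
def nv (x : d → K) : ℝ := ∑ i, ‖x i‖ ^ 2

lemma nv_nonneg (x : d → K) : 0 ≤ nv x := Finset.sum_nonneg fun _ _ => by positivity

lemma frobSq_cols (A : Matrix d n K) (N : Matrix n ι K) :
    frobSq (A * N) = ∑ j, nv (A *ᵥ fun i => N i j) := by
  unfold frobSq nv
  rw [Finset.sum_comm]
  rfl

lemma frobSq_eq_nv (N : Matrix n ι K) : frobSq N = ∑ j, nv (fun i => N i j) := by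
  unfold frobSq nv
  rw [Finset.sum_comm]

lemma nv_smul (t : K) (x : d → K) : nv (t • x) = ‖t‖ ^ 2 * nv x := by
  unfold nv
  rw [Finset.mul_sum]
  simp [norm_mul, mul_pow]

/-- A unitary fixing the coordinates `inl` and sending a given coordinate to `v`. -/
lemma exists_fix (e : ι ⊕ c ≃ d) (j0 : c) (v : d → K) (hv : ∀ i, v (e (Sum.inl i)) = 0)
    (hn : nv v = 1) :
    ∃ H ∈ Matrix.unitaryGroup d K, H * Ec K (e ∘ Sum.inl) = Ec K (e ∘ Sum.inl) ∧
      H *ᵥ (Pi.single (e (Sum.inr j0)) 1) = v := by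
  have hvv : ∑ k, star (v k) * v k = 1 := by
    have : ∀ k, star (v k) * v k = ((‖v k‖ ^ 2 : ℝ) : K) := by
      intro k
      rw [RCLike.star_def, RCLike.conj_mul]; push_cast; rfl
    simp only [this]
    rw [← RCLike.ofReal_sum]
    exact_mod_cast hn
  obtain ⟨H, hH, hHe⟩ := ext_unitary (K := K)
    (fun i => if i = e (Sum.inr j0) then v else Pi.single i 1)
    (insert (e (Sum.inr j0)) (Set.range (e ∘ Sum.inl))) (by
      have hne : ∀ i, e (Sum.inl i) ≠ e (Sum.inr j0) := fun i h => by
        have := e.injective h; simp at this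
      rintro i (rfl | ⟨i, rfl⟩) j (rfl | ⟨j, rfl⟩)
      · simpa using hvv
      · simp [hne, (hne j).symm, Pi.single_apply, hv]
      · simp [hne, Pi.single_apply, hv]
      · simp [hne, Pi.single_apply, eq_comm])
  refine ⟨H, hH, ?_, ?_⟩
  · rw [mul_Ec]
    ext k i
    have hne : e (Sum.inl i) ≠ e (Sum.inr j0) := fun h => by
        have := e.injective h; simp at this
    have := hHe (e (Sum.inl i)) (Or.inr ⟨i, rfl⟩) k
    rw [Matrix.submatrix_apply, id, Function.comp, this, if_neg hne]
    simp [Ec, Matrix.one_apply, Pi.single_apply]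
  · ext k
    have := hHe (e (Sum.inr j0)) (Or.inl rfl) k
    simp [this]

lemma step1 (eκ : κ ⊕ b ≃ d) (e : ι ⊕ c ≃ d) {Ψ : Matrix d κ K} (hΨ : FR Ψ)
    (hc : (Fintype.card ι : ℝ) + alphaK K < Fintype.card κ) {M : Matrix d ι K} (hM : FR M)
    {N : Matrix d n K} (hMN : Mᴴ * N = 0) :
    ENNReal.ofReal (frobSq N * ((Fintype.card b : ℝ) / Fintype.card c * (Fintype.card ι /
      ((Fintype.card κ : ℝ) - Fintype.card ι - alphaK K)))) ≤
      ∫⁻ U, ENNReal.ofReal (frobSq (M * yy Ψ (U * M) * (U * N))) ∂(Hu K d) := by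
  obtain ⟨W, hW, R, hR, h⟩ := exists_unitary_factor hM (e_inl_inj e)
  set E := Ec K (e ∘ Sum.inl) with hE
  have hEE : Eᴴ * E = 1 := Ec_isom (e_inl_inj e)
  set P : Matrix d d K → Matrix d d K := fun U => U * E * yy Ψ (U * E) * U with hP
  have hPm : Measurable P :=
    meas_mul (meas_mul (meas_mul measurable_id_mat measurable_const)
      (meas_yy measurable_const (meas_mul measurable_id_mat measurable_const))) measurable_id_mat
  set N' := Wᴴ * N with hN'
  have hWN : frobSq N' = frobSq N :=
    frobSq_isom_mul (by rw [conjTranspose_conjTranspose]; exact unitary_right hW) N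
  have hEN : ∀ j i, N' (e (Sum.inl i)) j = 0 := by
    have h1 : Eᴴ * N' = 0 := by
      have h2 : Rᴴ * (Eᴴ * N') = 0 := by
        rw [← hMN, h, conjTranspose_mul, conjTranspose_mul, hN']
        simp only [Matrix.mul_assoc]
      have hR' : IsUnit (Rᴴ).det := by rw [det_conjTranspose]; exact hR.star
      rw [← Matrix.nonsing_inv_mul_cancel_left Rᴴ (Eᴴ * N') hR', h2, Matrix.mul_zero]
    rw [Ec_conj_mul] at h1
    intro j i
    exact congrFun (congrFun h1 i) j
  -- rewrite the integral
  have hIntg : ∫⁻ U, ENNReal.ofReal (frobSq (M * yy Ψ (U * M) * (U * N))) ∂(Hu K d) =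
      ∫⁻ U, ENNReal.ofReal (frobSq (P U * N')) ∂(Hu K d) := by
    have hWc := unitary_conj hW
    have e1 : ∫⁻ U, ENNReal.ofReal (frobSq (M * yy Ψ (U * M) * (U * N))) ∂(Hu K d) =
      ∫⁻ U, ENNReal.ofReal (frobSq (U * (M * yy Ψ (U * M) * (U * N)))) ∂(Hu K d) := by
      refine lintegral_congr_ae ?_
      filter_upwards [Hu_ae (K := K) (m := d)] with U hU
      rw [frobSq_isom_mul (unitary_left hU)]
    rw [e1, ← Hu_right hWc (f := fun U =>
      ENNReal.ofReal (frobSq (U * (M * yy Ψ (U * M) * (U * N)))))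
      (meas_oF (meas_mul measurable_id_mat (meas_mul (meas_mul measurable_const
        (meas_yy measurable_const (meas_mul measurable_id_mat measurable_const)))
        (meas_mul measurable_id_mat measurable_const))))]
    refine lintegral_congr fun U => ?_
    congr 2
    have e2 : U * Wᴴ * M = U * E * R := by
      rw [h, ← Matrix.mul_assoc, ← Matrix.mul_assoc, Matrix.mul_assoc U, unitary_left hW,
        Matrix.mul_one]
    have e3 : U * Wᴴ * (M * yy Ψ (U * Wᴴ * M) * (U * Wᴴ * N)) =
        (U * Wᴴ * M) * yy Ψ (U * Wᴴ * M) * (U * (Wᴴ * N)) := by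
      simp only [Matrix.mul_assoc]
    rw [e3, e2, mul_yy_mul_unit _ _ hR, hP, hN']
    simp only [Matrix.mul_assoc]
  rw [hIntg, ← hWN]
  set C : ℝ := Fintype.card b * (Fintype.card ι /
      ((Fintype.card κ : ℝ) - Fintype.card ι - alphaK K)) with hC
  have hC0 : 0 ≤ C := by
    rw [hC]
    exact mul_nonneg (by positivity) (div_nonneg (by positivity) (by linarith))
  have hCeq : frobSq N' * ((Fintype.card b : ℝ) / Fintype.card c * (Fintype.card ι /
      ((Fintype.card κ : ℝ) - Fintype.card ι - alphaK K))) = frobSq N' * (C / Fintype.card c) := by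
    rw [hC]; ring
  rw [hCeq]
  rcases isEmpty_or_nonempty c with hce | hce
  · simp
  set φ : (d → K) → ℝ≥0∞ := fun v => ∫⁻ U, ENNReal.ofReal (nv (P U *ᵥ v)) ∂(Hu K d) with hφ
  have hφm : ∀ v : d → K, Measurable fun U : Matrix d d K => ENNReal.ofReal (nv (P U *ᵥ v)) := by
    intro v
    refine Measurable.ennreal_ofReal ?_
    unfold nv
    refine Finset.measurable_sum _ fun i _ => Measurable.pow_const (Measurable.norm ?_) 2
    exact Finset.measurable_sum _ fun j _ => (meas_entry hPm i j).mul_const _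
  -- invariance
  have hunit : ∀ v : d → K, (∀ i, v (e (Sum.inl i)) = 0) → nv v = 1 → ∀ j0 : c,
      φ v = φ (Pi.single (e (Sum.inr j0)) 1) := by
    intro v hv hn j0
    obtain ⟨H, hH, hHE, hHv⟩ := exists_fix e j0 v hv hn
    rw [← hE] at hHE
    rw [hφ]
    simp only
    rw [← Hu_right hH (hφm (Pi.single (e (Sum.inr j0)) 1))]
    refine lintegral_congr fun U => ?_
    congr 2
    have : P (U * H) = P U * H := by
      rw [hP]
      simp only
      rw [Matrix.mul_assoc U H E, hHE]
      simp only [Matrix.mul_assoc]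
    rw [this, ← hHv, Matrix.mulVec_mulVec]
  have hscale : ∀ v : d → K, (∀ i, v (e (Sum.inl i)) = 0) → ∀ j0 : c,
      ENNReal.ofReal (nv v) * φ (Pi.single (e (Sum.inr j0)) 1) ≤ φ v := by
    intro v hv j0
    by_cases h0 : nv v = 0
    · simp [h0]
    have hpos : 0 < nv v := lt_of_le_of_ne (nv_nonneg v) (Ne.symm h0)
    set s := Real.sqrt (nv v) with hs
    have hs0 : 0 < s := Real.sqrt_pos.2 hpos
    have hss : s ^ 2 = nv v := Real.sq_sqrt hpos.le
    set w : d → K := ((s⁻¹ : ℝ) : K) • v with hw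
    have hw1 : nv w = 1 := by
      rw [hw, nv_smul, RCLike.norm_ofReal, sq_abs, inv_pow, hss, inv_mul_cancel₀ h0]
    have hvw : v = ((s : ℝ) : K) • w := by
      rw [hw, smul_smul, ← RCLike.ofReal_mul, mul_inv_cancel₀ hs0.ne', RCLike.ofReal_one, one_smul]
    rw [← hunit w (fun i => by simp [hw, hv i]) hw1 j0]
    have : φ v = ENNReal.ofReal (nv v) * φ w := by
      rw [hφ]
      simp only
      rw [← lintegral_const_mul _ (hφm w)]
      refine lintegral_congr fun U => ?_
      conv_lhs => rw [hvw]
      rw [Matrix.mulVec_smul, nv_smul, RCLike.norm_ofReal, sq_abs, hss,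
        ENNReal.ofReal_mul hpos.le]
    rw [this]
  -- the trace
  have htr : ENNReal.ofReal C ≤ ∑ j0 : c, φ (Pi.single (e (Sum.inr j0)) 1) := by
    refine (FF_gauss (ι := ι) eκ hΨ hc).trans ?_
    rw [← Hu_gauss (meas_FF Ψ) (fun Z T hT => by
      unfold FF; rw [mul_yy_mul_unit _ _ hT, prj_mul_unit _ hT]) (FR_isom hEE), hφ]
    simp only
    rw [← lintegral_finsetSum _ fun j _ => hφm _]
    refine lintegral_mono_ae ?_
    filter_upwards [Hu_ae (K := K) (m := d)] with U hU
    rw [← ENNReal.ofReal_sum_of_nonneg fun _ _ => nv_nonneg _]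
    apply ENNReal.ofReal_le_ofReal
    have hprE : prj E = E * Eᴴ := by rw [prj, linv, hEE]; simp
    have e1 : U * E * yy Ψ (U * E) * (1 - prj (U * E)) = P U * (1 - E * Eᴴ) * Uᴴ := by
      rw [prj_isom_mul (unitary_left hU), hprE, hP]
      simp only
      have : 1 - U * (E * Eᴴ) * Uᴴ = U * (1 - E * Eᴴ) * Uᴴ := by
        rw [Matrix.mul_sub, Matrix.sub_mul, Matrix.mul_one, unitary_right hU]
      rw [this]
      simp only [Matrix.mul_assoc]
    rw [e1, frobSq_mul_coisom (by rw [conjTranspose_conjTranspose]; exact unitary_left hU)]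
    have hcol : ∀ j, (fun i => (1 - E * Eᴴ : Matrix d d K) i j) =
        Sum.elim (fun _ => 0) (fun j0 => Pi.single (e (Sum.inr j0)) 1) (e.symm j) := by
      intro j
      obtain ⟨j, rfl⟩ := e.surjective j
      rw [e.symm_apply_apply]
      ext i
      rcases j with j | j
      · have : (E * Eᴴ) i (e (Sum.inl j)) = (E * (Eᴴ * E)) i j := by
          rw [← Matrix.mul_assoc, hE, mul_Ec]; rfl
        rw [Matrix.sub_apply, this, hEE, Matrix.mul_one]
        exact sub_self _
      · have : (E * Eᴴ) i (e (Sum.inr j)) = 0 := by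
          rw [Matrix.mul_apply]
          refine Finset.sum_eq_zero fun k _ => ?_
          simp [hE, Ec]
        rw [Matrix.sub_apply, this, sub_zero]
        simp [Matrix.one_apply, Pi.single_apply]
    rw [frobSq_cols]
    simp only [hcol]
    rw [← e.sum_comp, Fintype.sum_sum_type]
    simp [nv]
  have hcpos : (0 : ℝ) < Fintype.card c := by exact_mod_cast Fintype.card_pos
  have hvec : ∀ v : d → K, (∀ i, v (e (Sum.inl i)) = 0) →
      ENNReal.ofReal (nv v * (C / Fintype.card c)) ≤ φ v := by
    intro v hv
    have h1 : ENNReal.ofReal (nv v) * ENNReal.ofReal C ≤ (Fintype.card c : ℝ≥0∞) * φ v := by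
      calc _ ≤ ENNReal.ofReal (nv v) * ∑ j0 : c, φ (Pi.single (e (Sum.inr j0)) 1) := by gcongr
        _ = ∑ j0 : c, ENNReal.ofReal (nv v) * φ (Pi.single (e (Sum.inr j0)) 1) := by
          rw [Finset.mul_sum]
        _ ≤ ∑ j0 : c, φ v := Finset.sum_le_sum fun j0 _ => hscale v hv j0
        _ = _ := by simp
    rw [← mul_div_assoc, ENNReal.ofReal_div_of_pos hcpos, ENNReal.ofReal_mul (nv_nonneg v),
      ENNReal.ofReal_natCast]
    exact ENNReal.div_le_of_le_mul' h1
  have hfin : ∀ U : Matrix d d K, ENNReal.ofReal (frobSq (P U * N')) =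
      ∑ j, ENNReal.ofReal (nv (P U *ᵥ fun i => N' i j)) := by
    intro U
    rw [frobSq_cols, ENNReal.ofReal_sum_of_nonneg fun _ _ => nv_nonneg _]
  simp only [hfin]
  rw [lintegral_finsetSum _ fun j _ => hφm _, frobSq_eq_nv, Finset.sum_mul,
    ENNReal.ofReal_sum_of_nonneg fun _ _ => mul_nonneg (nv_nonneg _) (by positivity)]
  exact Finset.sum_le_sum fun j _ => hvec _ (hEN j)

end steponeb

section ptwise
set_option linter.unusedSectionVars false
variable {K : Type*} [RCLike K] [MeasurableSpace K] [BorelSpace K]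
variable {d n ι κ b c : Type*} [Fintype d] [Fintype n] [Fintype ι] [Fintype κ]
  [DecidableEq d] [DecidableEq n] [DecidableEq ι] [DecidableEq κ]
  [Fintype b] [DecidableEq b] [Fintype c] [DecidableEq c]

lemma prj_orth {M : Matrix d ι K} (hM : FR M) (B : Matrix d n K) : Mᴴ * (B - prj M * B) = 0 := by
  have h : Mᴴ * prj M = Mᴴ := by
    have := congrArg conjTranspose (prj_mul hM)
    rwa [conjTranspose_mul, prj_herm] at this
  rw [Matrix.mul_sub, ← Matrix.mul_assoc, h, sub_self]

lemma pointwise {U : Matrix d d K} (hU : U ∈ Matrix.unitaryGroup d K) (B : Matrix d n K)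
    (Ω : Matrix n ι K) (Ψ : Matrix d κ K) (hM : FR (B * Ω)) (hG : FR (Ψᴴ * (U * (B * Ω)))) :
    frobSq (U * B - (U * B * Ω) * (linv (Ψᴴ * (U * B) * Ω) * (Ψᴴ * (U * B)))) =
      frobSq (B - prj (B * Ω) * B) +
      frobSq (B * Ω * yy Ψ (U * (B * Ω)) * (U * (B - prj (B * Ω) * B))) := by
  set M := B * Ω with hMdef
  set N := B - prj M * B with hN
  have h1 : yy Ψ (U * M) * (U * (prj M * B)) = linv M * B := by
    have : U * (prj M * B) = (U * M) * (linv M * B) := by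
      rw [prj]; simp only [Matrix.mul_assoc]
    rw [this, ← Matrix.mul_assoc, yy_mul hG, Matrix.one_mul]
  have h2 : linv (Ψᴴ * (U * B) * Ω) * (Ψᴴ * (U * B)) = yy Ψ (U * M) * (U * B) := by
    rw [yy, hMdef]; simp only [Matrix.mul_assoc]
  have hB : B = N + prj M * B := by rw [hN]; simp
  have h3 : yy Ψ (U * M) * (U * B) = yy Ψ (U * M) * (U * N) + linv M * B := by
    conv_lhs => rw [hB]
    rw [Matrix.mul_add, Matrix.mul_add, h1]
  have h4 : U * B - (U * B * Ω) * (linv (Ψᴴ * (U * B) * Ω) * (Ψᴴ * (U * B))) =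
      U * (N + -(M * yy Ψ (U * M) * (U * N))) := by
    rw [h2, h3, Matrix.mul_assoc U B Ω, ← hMdef, Matrix.mul_add, Matrix.mul_add, hN,
      Matrix.mul_sub U, Matrix.mul_neg, prj]
    simp only [Matrix.mul_assoc]
    abel
  rw [h4, frobSq_isom_mul (unitary_left hU), frobSq_add]
  · congr 1
    simp [frobSq]
  · have := congrArg conjTranspose (prj_orth hM B)
    rw [conjTranspose_mul, conjTranspose_conjTranspose, conjTranspose_zero, ← hN] at this
    rw [Matrix.mul_neg, Matrix.mul_assoc, ← Matrix.mul_assoc Nᴴ, this]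
    simp

open Classical in
/-- Measurable version of the error. -/
def errM (Ω : Matrix n ι K) (Ψ : Matrix d κ K) (A : Matrix d n K) : ℝ≥0∞ :=
  if FR (Ψᴴ * A * Ω) then
    ENNReal.ofReal (frobSq (A - (A * Ω) * (linv (Ψᴴ * A * Ω) * (Ψᴴ * A)))) else 0

lemma meas_errM {X : Type*} [MeasurableSpace X] {f : X → Matrix n ι K} {g : X → Matrix d κ K}
    {h : X → Matrix d n K} (hf : Measurable f) (hg : Measurable g) (hh : Measurable h) :
    Measurable fun x => errM (f x) (g x) (h x) := by
  classical
  unfold errM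
  have hG := meas_mul (meas_mul (meas_conjT hg) hh) hf
  refine Measurable.ite (meas_FR hG) ?_ measurable_const
  exact meas_oF (meas_sub hh (meas_mul (meas_mul hh hf) (meas_mul (meas_linv hG)
    (meas_mul (meas_conjT hg) hh))))

lemma errM_le (Ω : Matrix n ι K) (Ψ : Matrix d κ K) (A : Matrix d n K) {X : Matrix ι κ K}
    (hX : IsMoorePenrose (Ψᴴ * A * Ω) X) :
    errM Ω Ψ A ≤ ENNReal.ofReal (frobSq (A - (A * Ω) * (X * (Ψᴴ * A)))) := by
  unfold errM
  split_ifs with h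
  · rw [pinv_eq_linv h hX]
  · exact zero_le

lemma avgU (eκ : κ ⊕ b ≃ d) (e : ι ⊕ c ≃ d) {Ψ : Matrix d κ K} (hΨ : FR Ψ)
    (hc : (Fintype.card ι : ℝ) + alphaK K < Fintype.card κ) {Ω : Matrix n ι K}
    {B : Matrix d n K} (hM : FR (B * Ω)) :
    ENNReal.ofReal (1 + ((Fintype.card b : ℝ) / Fintype.card c * (Fintype.card ι /
      ((Fintype.card κ : ℝ) - Fintype.card ι - alphaK K)))) *
      ENNReal.ofReal (frobSq (B - prj (B * Ω) * B)) ≤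
      ∫⁻ U, errM Ω Ψ (U * B) ∂(Hu K d) := by
  have h1 := step1 eκ e hΨ hc hM (prj_orth hM B)
  have hcard : Fintype.card ι ≤ Fintype.card κ := by
    have : 0 ≤ alphaK K := by unfold alphaK; split_ifs <;> simp
    have : (Fintype.card ι : ℝ) < Fintype.card κ := by linarith
    exact_mod_cast this.le
  have hae := ae_FR_sketch eκ hΨ hcard hM
  have h0 : 0 ≤ (Fintype.card b : ℝ) / Fintype.card c * (Fintype.card ι /
      ((Fintype.card κ : ℝ) - Fintype.card ι - alphaK K)) :=
    mul_nonneg (by positivity) (div_nonneg (by positivity) (by linarith))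
  set g := (Fintype.card b : ℝ) / Fintype.card c * (Fintype.card ι /
      ((Fintype.card κ : ℝ) - Fintype.card ι - alphaK K))
  have h2 : ∫⁻ U, errM Ω Ψ (U * B) ∂(Hu K d) =
      ∫⁻ U, (ENNReal.ofReal (frobSq (B - prj (B * Ω) * B)) +
      ENNReal.ofReal (frobSq (B * Ω * yy Ψ (U * (B * Ω)) * (U * (B - prj (B * Ω) * B)))))
        ∂(Hu K d) := by
    refine lintegral_congr_ae ?_
    filter_upwards [Hu_ae (K := K) (m := d), hae] with U hU hG
    have hG' : Ψᴴ * (U * B) * Ω = Ψᴴ * (U * (B * Ω)) := by simp only [Matrix.mul_assoc]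
    rw [errM, if_pos (by rw [hG']; exact hG), pointwise hU B Ω Ψ hM hG,
      ENNReal.ofReal_add (frobSq_nonneg _) (frobSq_nonneg _)]
  rw [h2, lintegral_add_left measurable_const, lintegral_const, measure_univ, mul_one,
    ← ENNReal.ofReal_mul (by linarith), add_mul, one_mul,
    ENNReal.ofReal_add (frobSq_nonneg _) (mul_nonneg h0 (frobSq_nonneg _)), mul_comm g]
  gcongr

end ptwise

section steptwo
set_option linter.unusedSectionVars false
variable {K : Type*} [RCLike K] [MeasurableSpace K] [BorelSpace K]
variable {d n ι κ a b c s ρ : Type*} [Fintype d] [Fintype n] [Fintype ι] [Fintype κ]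
  [DecidableEq d] [DecidableEq n] [DecidableEq ι] [DecidableEq κ]
  [Fintype b] [DecidableEq b] [Fintype c] [DecidableEq c]
  [Fintype a] [DecidableEq a] [Fintype s] [DecidableEq s] [Fintype ρ] [DecidableEq ρ]

/-- Residual of the range finder. -/
def rho (S : Matrix ρ ρ K) (C : Matrix ρ ι K) : ℝ≥0∞ :=
  ENNReal.ofReal (frobSq (S - prj (S * C) * S))

lemma meas_rho (S : Matrix ρ ρ K) : Measurable (rho (ι := ι) S) :=
  meas_oF (meas_sub measurable_const (meas_mul (meas_prj (meas_mul measurable_const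
    measurable_id_mat)) measurable_const))

lemma rho_unit (S : Matrix ρ ρ K) (Z : Matrix ρ ι K) (T : Matrix ι ι K) (hT : IsUnit T.det) :
    rho S (Z * T) = rho S Z := by
  unfold rho
  rw [← Matrix.mul_assoc, prj_mul_unit _ hT]

lemma resid_eq {W1 : Matrix d ρ K} (h1 : W1ᴴ * W1 = 1) {W2 : Matrix ρ n K} (h2 : W2 * W2ᴴ = 1)
    (S : Matrix ρ ρ K) (Ω : Matrix n ι K) :
    ENNReal.ofReal (frobSq (W1 * (S * W2) - prj (W1 * (S * W2) * Ω) * (W1 * (S * W2)))) =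
      rho S (W2 * Ω) := by
  have e1 : W1 * (S * W2) * Ω = W1 * (S * (W2 * Ω)) := by simp only [Matrix.mul_assoc]
  have e2 : W1 * (S * W2) - prj (W1 * (S * W2) * Ω) * (W1 * (S * W2)) =
      W1 * ((S - prj (S * (W2 * Ω)) * S) * W2) := by
    rw [e1, prj_isom_mul h1, Matrix.sub_mul, Matrix.mul_sub]
    congr 1
    simp only [Matrix.mul_assoc]
    rw [← Matrix.mul_assoc W1ᴴ W1, h1, Matrix.one_mul]
  rw [e2, frobSq_isom_mul h1, frobSq_mul_coisom h2, rho]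

lemma avgV (en : ρ ⊕ b ≃ n) {f : Matrix ρ ι K → ℝ≥0∞} (hf : Measurable f)
    (hfT : ∀ (Z : Matrix ρ ι K) (T : Matrix ι ι K), IsUnit T.det → f (Z * T) = f Z)
    {Ω : Matrix n ι K} (hΩ : FR Ω) :
    ∫⁻ V, f ((Ec K (en ∘ Sum.inl))ᴴ * V * Ω) ∂(Hu K n) = ∫⁻ Z, f Z ∂(Gm K ρ ι) := by
  have hm : Measurable fun Z : Matrix n ι K => f ((Ec K (en ∘ Sum.inl))ᴴ * Z) :=
    hf.comp (meas_mul measurable_const measurable_id_mat)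
  have h := Hu_gauss (f := fun Z : Matrix n ι K => f ((Ec K (en ∘ Sum.inl))ᴴ * Z)) hm
    (fun Z T hT => by rw [← Matrix.mul_assoc, hfT _ _ hT]) hΩ
  simp only [← Matrix.mul_assoc] at h
  rw [h, lint_split en hm]
  simp only [Ec_split]
  simp

lemma complement_le (e : ι ⊕ c ≃ ρ) {S S' : Matrix ρ ρ K} (hS : Sᴴ = S) (hSS' : S * S' = 1) :
    ∫⁻ D, ENNReal.ofReal (frobSq (prj (S' * D) * S)) ∂(Gm K ρ c) ≤
      ∫⁻ C, rho S C ∂(Gm K ρ ι) := by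
  have hinr : Function.Injective (e ∘ Sum.inr) := e.injective.comp Sum.inr_injective
  have hE1 : FR (Ec K (e ∘ Sum.inl)) := FR_isom (Ec_isom (e_inl_inj e))
  have hE2 : FR (Ec K (e ∘ Sum.inr)) := FR_isom (Ec_isom hinr)
  have hE12 : (Ec K (e ∘ Sum.inl))ᴴ * Ec K (e ∘ Sum.inr) = 0 := by
    rw [Ec_conj_mul]
    ext i j
    simp [Ec, Matrix.one_apply]
  have hS'S : S' * S = 1 := mul_eq_one_comm.1 hSS'
  have uS : IsUnit S.det := by
    rw [← Matrix.isUnit_iff_isUnit_det]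
    exact ⟨⟨S, S', hSS', hS'S⟩, rfl⟩
  have uS' : IsUnit S'.det := by
    rw [← Matrix.isUnit_iff_isUnit_det]
    exact ⟨⟨S', S, hS'S, hSS'⟩, rfl⟩
  rw [← Hu_gauss (meas_rho S) (rho_unit S) hE1,
    ← Hu_gauss (f := fun D : Matrix ρ c K => ENNReal.ofReal (frobSq (prj (S' * D) * S)))
      (meas_oF (meas_mul (meas_prj (meas_mul measurable_const measurable_id_mat))
        measurable_const))
      (fun Z T hT => by rw [← Matrix.mul_assoc, prj_mul_unit _ hT]) hE2]
  refine lintegral_mono_ae ?_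
  filter_upwards [Hu_ae (K := K) (m := ρ)] with U hU
  unfold rho
  apply ENNReal.ofReal_le_ofReal
  set C := U * Ec K (e ∘ Sum.inl)
  set D := U * Ec K (e ∘ Sum.inr)
  have hC : FR (S * C) := FR_mul (FR_unit uS) (FR_mul (FR_isom (unitary_left hU)) hE1)
  have hD : FR (S' * D) := FR_mul (FR_unit uS') (FR_mul (FR_isom (unitary_left hU)) hE2)
  have hCD : Cᴴ * D = 0 := by
    rw [conjTranspose_mul, Matrix.mul_assoc, ← Matrix.mul_assoc Uᴴ, unitary_left hU,
      Matrix.one_mul, hE12]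
  have hX : (S * C)ᴴ * (S' * D) = 0 := by
    rw [conjTranspose_mul, hS, Matrix.mul_assoc, ← Matrix.mul_assoc S, hSS', Matrix.one_mul, hCD]
  have hPQ : prj (S * C) * prj (S' * D) = 0 := by
    rw [prj, linv, prj]
    generalize S * C = X1 at hX ⊢
    generalize S' * D = X2 at hX ⊢
    simp only [Matrix.mul_assoc]
    rw [← Matrix.mul_assoc X1ᴴ X2, hX]
    simp
  have hQP : prj (S' * D) * prj (S * C) = 0 := by
    have := congrArg conjTranspose hPQ
    rwa [conjTranspose_mul, prj_herm, prj_herm, conjTranspose_zero] at this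
  set P := prj (S * C)
  set Q := prj (S' * D) with hQ
  have hdec : S - P * S = Q * S + (1 - P - Q) * S := by
    rw [← Matrix.add_mul]
    have : Q + (1 - P - Q) = 1 - P := by abel
    rw [this, Matrix.sub_mul, Matrix.one_mul]
  rw [hdec, frobSq_add]
  · linarith [frobSq_nonneg ((1 - P - Q) * S)]
  · rw [conjTranspose_mul, hQ, prj_herm, ← hQ, Matrix.mul_assoc, ← Matrix.mul_assoc Q]
    have : Q * (1 - P - Q) = 0 := by
      rw [Matrix.mul_sub, Matrix.mul_sub, hQP, hQ, prj_sq hD]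
      simp
    rw [this]
    simp

/-- The diagonal scaling. -/
def Sd (K : Type*) [RCLike K] (eq : s ⊕ a ≃ ρ) (t : ℝ) : Matrix ρ ρ K :=
  Matrix.diagonal fun i => Sum.elim (fun _ => (t : K)) (fun _ => 1) (eq.symm i)

lemma Sd_herm (eq : s ⊕ a ≃ ρ) (t : ℝ) : (Sd K eq t)ᴴ = Sd K eq t := by
  unfold Sd
  rw [diagonal_conjTranspose]
  congr 1
  ext i
  rcases h : eq.symm i with j | j <;> simp [h]

lemma Sd_mul (eq : s ⊕ a ≃ ρ) {t : ℝ} (ht : t ≠ 0) : Sd K eq t * Sd K eq t⁻¹ = 1 := by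
  unfold Sd
  rw [diagonal_mul_diagonal, ← diagonal_one]
  congr 1
  ext i
  rcases h : eq.symm i with j | j <;> simp [ht]

lemma Sd_split (eq : s ⊕ a ≃ ρ) (t : ℝ) (A : Matrix s c K) (B : Matrix a c K) :
    Sd K eq t * ((fromRows A B).submatrix eq.symm id) =
      (fromRows ((t : K) • A) B).submatrix eq.symm id := by
  ext i j
  obtain ⟨i, rfl⟩ := eq.surjective i
  rcases i with i | i <;> simp [Sd, Matrix.diagonal_mul, RCLike.real_smul_eq_coe_mul]

/-- pointwise limit -/
lemma lim_pt (eq : s ⊕ a ≃ ρ) (A : Matrix s c K) {B : Matrix a c K} (hB : FR B) :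
    Tendsto (fun m : ℕ => ENNReal.ofReal (frobSq (prj (Sd K eq ((m : ℝ) + 1)⁻¹ *
      ((fromRows A B).submatrix eq.symm id)) * Sd K eq ((m : ℝ) + 1)))) atTop
      (𝓝 (ENNReal.ofReal (frobSq (A * linv B) + Fintype.card c))) := by
  set D := (fromRows A B).submatrix eq.symm id with hD
  set X : ℝ → Matrix ρ c K := fun u => Sd K eq u * D with hX
  have hXc : Continuous X := by
    refine Continuous.matrix_mul ?_ continuous_const
    unfold Sd
    refine Continuous.matrix_diagonal ?_
    refine continuous_pi fun i => ?_
    rcases eq.symm i with j | j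
    · simpa using RCLike.continuous_ofReal
    · simpa using continuous_const
  have hX0 : X 0 = (fromRows (0 : Matrix s c K) B).submatrix eq.symm id := by
    rw [hX]; simp only; rw [hD, Sd_split]; simp
  have hXX : (X 0)ᴴ * X 0 = Bᴴ * B := by
    rw [hX0]
    ext i j
    simp only [Matrix.mul_apply, Matrix.conjTranspose_apply, Matrix.submatrix_apply]
    rw [← eq.sum_comp, Fintype.sum_sum_type]
    simp
  have hinv : ContinuousAt (fun u => ((X u)ᴴ * X u)⁻¹) 0 := by
    have hc : Continuous fun u => (X u)ᴴ * X u :=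
      hXc.matrix_conjTranspose.matrix_mul hXc
    have h1 : ContinuousAt (fun M : Matrix c c K => M⁻¹) ((X 0)ᴴ * X 0) := by
      apply continuousAt_matrix_inv
      rw [hXX, Ring.inverse_eq_inv']
      exact continuousAt_inv₀ hB
    exact ContinuousAt.comp (f := fun u => (X u)ᴴ * X u) (x := (0 : ℝ)) h1 hc.continuousAt
  have hfc : Continuous (frobSq : Matrix ρ ρ K → ℝ) := by
    unfold frobSq
    fun_prop
  have hF : ContinuousAt (fun u => ENNReal.ofReal
      (frobSq (X u * (((X u)ᴴ * X u)⁻¹ * Dᴴ)))) 0 := by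
    refine ENNReal.continuous_ofReal.continuousAt.comp (hfc.continuousAt.comp ?_)
    have hm : Continuous fun p : Matrix ρ c K × Matrix c c K => p.1 * (p.2 * Dᴴ) :=
      continuous_fst.matrix_mul (continuous_snd.matrix_mul continuous_const)
    exact ContinuousAt.comp (f := fun u => (X u, ((X u)ᴴ * X u)⁻¹)) (x := (0 : ℝ))
      hm.continuousAt (hXc.continuousAt.prodMk hinv)
  have hlim : Tendsto (fun m : ℕ => ((m : ℝ) + 1)⁻¹) atTop (𝓝 0) := by
    simpa [one_div] using tendsto_one_div_add_atTop_nhds_zero_nat (𝕜 := ℝ)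
  have h := hF.tendsto.comp hlim
  have hval : frobSq (X 0 * (((X 0)ᴴ * X 0)⁻¹ * Dᴴ)) = frobSq (A * linv B) + Fintype.card c := by
    rw [hXX, hX0, split_mul, frobSq_split, Matrix.zero_mul]
    have h0 : frobSq (0 : Matrix s ρ K) = 0 := by simp [frobSq]
    have h1 : B * ((Bᴴ * B)⁻¹ * Dᴴ) = (D * linv B)ᴴ := by
      rw [conjTranspose_mul, linv, conjTranspose_mul, conjTranspose_conjTranspose,
        conjTranspose_nonsing_inv, conjTranspose_mul, conjTranspose_conjTranspose,
        Matrix.mul_assoc]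
    rw [h0, zero_add, h1, frobSq_conjTranspose, hD, split_mul, frobSq_split]
    congr 1
    exact frobSq_prj hB
  rw [hval] at h
  refine h.congr fun m => ?_
  simp only [Function.comp]
  congr 2
  have hm : ((m : ℝ) + 1) ≠ 0 := by positivity
  have e1 : (X ((m : ℝ) + 1)⁻¹)ᴴ * Sd K eq ((m : ℝ) + 1) = Dᴴ := by
    rw [hX]
    simp only
    rw [conjTranspose_mul, Sd_herm, Matrix.mul_assoc, mul_eq_one_comm.1 (Sd_mul eq hm),
      Matrix.mul_one]
  rw [prj, linv]
  change _ = X _ * (((X _)ᴴ * X _)⁻¹ * (X _)ᴴ) * _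
  generalize X ((m : ℝ) + 1)⁻¹ = X1 at e1 ⊢
  rw [← e1]
  simp only [Matrix.mul_assoc]

lemma step2 (e : ι ⊕ c ≃ ρ) (eq : s ⊕ a ≃ ρ) (hca : Fintype.card c + alphaK K ≤ Fintype.card a) :
    ENNReal.ofReal (Fintype.card c * (1 + Fintype.card s / ((Fintype.card a : ℝ) -
      Fintype.card c - alphaK K))) ≤
      liminf (fun m : ℕ => ∫⁻ C, rho (ι := ι) (Sd K eq ((m : ℝ) + 1)) C ∂(Gm K ρ ι)) atTop := by
  have hα : 0 ≤ alphaK K := by unfold alphaK; split_ifs <;> simp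
  have hcard : Fintype.card c ≤ Fintype.card a := by
    have : (Fintype.card c : ℝ) ≤ Fintype.card a := by linarith
    exact_mod_cast this
  set g : ℕ → Matrix ρ c K → ℝ≥0∞ := fun m D => ENNReal.ofReal (frobSq
    (prj (Sd K eq ((m : ℝ) + 1)⁻¹ * D) * Sd K eq ((m : ℝ) + 1))) with hg
  have hgm : ∀ m, Measurable (g m) := fun m =>
    meas_oF (meas_mul (meas_prj (meas_mul measurable_const measurable_id_mat)) measurable_const)
  have h1 : liminf (fun m : ℕ => ∫⁻ D, g m D ∂(Gm K ρ c)) atTop ≤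
      liminf (fun m : ℕ => ∫⁻ C, rho (ι := ι) (Sd K eq ((m : ℝ) + 1)) C ∂(Gm K ρ ι)) atTop := by
    refine liminf_le_liminf (Eventually.of_forall fun m => ?_)
    exact complement_le e (Sd_herm eq _) (Sd_mul eq (by positivity))
  refine le_trans ?_ h1
  refine le_trans ?_ (lintegral_liminf_le hgm)
  have hlm : Measurable fun D => liminf (fun m => g m D) atTop := Measurable.liminf hgm
  have hF : ∫⁻ D, liminf (fun m => g m D) atTop ∂(Gm K ρ c) =
      ∫⁻ B, ∫⁻ A, liminf (fun m => g m ((fromRows A B).submatrix eq.symm id)) atTop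
        ∂(Gm K s c) ∂(Gm K a c) := by
    have := lint_split ((Equiv.sumComm a s).trans eq) hlm
    rw [this]
    refine lintegral_congr fun B => lintegral_congr fun A => ?_
    have : (fromRows B A).submatrix ((Equiv.sumComm a s).trans eq).symm id =
        (fromRows A B).submatrix eq.symm id := by
      ext i j
      obtain ⟨i, rfl⟩ := eq.surjective i
      rcases i with i | i <;> simp
    rw [this]
  rw [hF]
  have hF2 : ∫⁻ B, ∫⁻ A, liminf (fun m => g m ((fromRows A B).submatrix eq.symm id)) atTop
        ∂(Gm K s c) ∂(Gm K a c) =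
      ∫⁻ B, ∫⁻ A, ENNReal.ofReal (frobSq (A * linv B)) ∂(Gm K s c) ∂(Gm K a c) +
        ENNReal.ofReal (Fintype.card c) := by
    have : ∀ᵐ B ∂(Gm K a c), ∫⁻ A, liminf (fun m => g m ((fromRows A B).submatrix eq.symm id))
        atTop ∂(Gm K s c) = ∫⁻ A, ENNReal.ofReal (frobSq (A * linv B)) ∂(Gm K s c) +
          ENNReal.ofReal (Fintype.card c) := by
      filter_upwards [ae_FR (K := K) hcard] with B hB
      have : ∀ A : Matrix s c K,
          liminf (fun m => g m ((fromRows A B).submatrix eq.symm id)) atTop =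
          ENNReal.ofReal (frobSq (A * linv B)) + ENNReal.ofReal (Fintype.card c) := by
        intro A
        rw [(lim_pt eq A hB).liminf_eq, ENNReal.ofReal_add (frobSq_nonneg _) (by positivity)]
      simp only [this]
      rw [lintegral_add_right _ measurable_const]
      simp
    rw [lintegral_congr_ae this, lintegral_add_right _ measurable_const]
    simp
  rw [hF2]
  rcases eq_or_lt_of_le hca with h0 | hlt
  · have : (Fintype.card a : ℝ) - Fintype.card c - alphaK K = 0 := by linarith
    rw [this, div_zero, add_zero, mul_one]
    exact le_add_self
  · have hmain := gauss_main (K := K) (b := s) (a := a) (ι := c) linv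
      (meas_linv measurable_id_mat) (by
        filter_upwards [ae_FR (K := K) hcard] with B hB using linv_mul hB) hlt
    have hden : 0 < (Fintype.card a : ℝ) - Fintype.card c - alphaK K := by linarith
    have : (Fintype.card c : ℝ) * (1 + Fintype.card s / ((Fintype.card a : ℝ) -
      Fintype.card c - alphaK K)) = Fintype.card s * (Fintype.card c / ((Fintype.card a : ℝ) -
      Fintype.card c - alphaK K)) + Fintype.card c := by
      field_simp
      ring
    rw [this, ENNReal.ofReal_add (by positivity) (by positivity)]
    gcongr

end steptwo

section eckart
set_option linter.unusedSectionVars false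
variable {K : Type*} [RCLike K]
variable {d n a s ρ : Type*} [Fintype d] [Fintype n]
  [DecidableEq d] [DecidableEq n]
  [Fintype a] [DecidableEq a] [Fintype s] [DecidableEq s] [Fintype ρ] [DecidableEq ρ]

lemma frobSq_diagonal (v : ρ → K) : frobSq (Matrix.diagonal v) = ∑ i, ‖v i‖ ^ 2 := by
  unfold frobSq
  refine Finset.sum_congr rfl fun i _ => ?_
  rw [Finset.sum_eq_single i]
  · simp
  · intro j _ hj
    simp [Matrix.diagonal_apply_ne _ hj.symm]
  · simp

lemma frobSq_mul_isom_le {W : Matrix d ρ K} (hW : Wᴴ * W = 1) (X : Matrix n d K) :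
    frobSq (X * W) ≤ frobSq X := by
  have h : X = X * (W * Wᴴ) + X * (1 - W * Wᴴ) := by
    rw [← Matrix.mul_add]; simp
  have h1 : frobSq X = frobSq (X * (W * Wᴴ)) + frobSq (X * (1 - W * Wᴴ)) := by
    conv_lhs => rw [h]
    apply frobSq_add'
    rw [conjTranspose_mul, conjTranspose_sub, conjTranspose_mul, conjTranspose_conjTranspose,
      conjTranspose_one, Matrix.mul_assoc, ← Matrix.mul_assoc (W * Wᴴ)]
    have : W * Wᴴ * (1 - W * Wᴴ) = 0 := by
      rw [Matrix.mul_sub, Matrix.mul_one, Matrix.mul_assoc W, ← Matrix.mul_assoc Wᴴ, hW,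
        Matrix.one_mul, sub_self]
    rw [this]
    simp
  have h2 : frobSq (X * (W * Wᴴ)) = frobSq (X * W) := by
    rw [← Matrix.mul_assoc]
    exact frobSq_mul_coisom (by rw [conjTranspose_conjTranspose]; exact hW) _
  linarith [frobSq_nonneg (X * (1 - W * Wᴴ))]

lemma trace_idem {P : Matrix d d K} (h : P * P = P) : P.trace = (P.rank : K) := by
  have hp : LinearMap.IsProj (LinearMap.range P.toLin') P.toLin' := by
    refine ⟨fun x => LinearMap.mem_range_self _ x, ?_⟩
    rintro _ ⟨x, rfl⟩
    simp only [Matrix.toLin'_apply, Matrix.mulVec_mulVec, h]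
  have := hp.trace
  rw [Matrix.trace_toLin'_eq] at this
  rw [this]
  rfl

lemma Sd_frob (eq : s ⊕ a ≃ ρ) (t : ℝ) :
    frobSq (Sd K eq t) = Fintype.card s * t ^ 2 + Fintype.card a := by
  unfold Sd
  rw [frobSq_diagonal, ← eq.sum_comp, Fintype.sum_sum_type]
  simp

lemma frobSq_mul_Sd_le (eq : s ⊕ a ≃ ρ) {t : ℝ} (ht : 1 ≤ t) (X : Matrix n ρ K) :
    frobSq (X * Sd K eq t) ≤ t ^ 2 * frobSq X := by
  unfold frobSq Sd
  rw [Finset.mul_sum]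
  refine Finset.sum_le_sum fun i _ => ?_
  rw [Finset.mul_sum]
  refine Finset.sum_le_sum fun j _ => ?_
  rw [Matrix.mul_diagonal, norm_mul, mul_pow, mul_comm]
  refine mul_le_mul_of_nonneg_right ?_ (by positivity)
  rcases eq.symm j with k | k
  · simp
  · simp only [Sum.elim_inr, norm_one]
    nlinarith

lemma rank_A {W1 : Matrix d ρ K} (h1 : W1ᴴ * W1 = 1) {W2 : Matrix ρ n K} (h2 : W2 * W2ᴴ = 1)
    (eq : s ⊕ a ≃ ρ) {t : ℝ} (ht : 1 ≤ t) :
    (W1 * (Sd K eq t * W2)).rank = Fintype.card ρ := by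
  have hS : (Sd K eq t).rank = Fintype.card ρ := by
    apply Matrix.rank_of_isUnit
    have h := Sd_mul (K := K) eq (t := t) (by positivity)
    exact ⟨⟨_, _, h, mul_eq_one_comm.1 h⟩, rfl⟩
  have e : Sd K eq t = W1ᴴ * ((W1 * (Sd K eq t * W2)) * W2ᴴ) := by
    simp only [Matrix.mul_assoc]
    rw [h2, Matrix.mul_one, ← Matrix.mul_assoc, h1, Matrix.one_mul]
  apply le_antisymm
  · rw [← hS]
    exact (Matrix.rank_mul_le_right _ _).trans (Matrix.rank_mul_le_left _ _)
  · rw [← hS]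
    conv_lhs => rw [e]
    exact (Matrix.rank_mul_le_right _ _).trans (Matrix.rank_mul_le_left _ _)

lemma exists_best {W1 : Matrix d ρ K} (h1 : W1ᴴ * W1 = 1) {W2 : Matrix ρ n K}
    (h2 : W2 * W2ᴴ = 1) (eq : s ⊕ a ≃ ρ) {t : ℝ} (ht : 1 ≤ t)
    (hp : ∀ B : Matrix d n K, ∃ X, IsMoorePenrose B X) :
    ∃ Aq, IsBestRankApprox (Fintype.card s) (W1 * (Sd K eq t * W2)) Aq ∧
      frobSq (W1 * (Sd K eq t * W2) - Aq) = Fintype.card a := by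
  set Sq : Matrix ρ ρ K :=
    Matrix.diagonal fun i => Sum.elim (fun _ => (t : K)) (fun _ => 0) (eq.symm i) with hSq
  have ht0 : (t : K) ≠ 0 := by
    have : t ≠ 0 := by positivity
    exact_mod_cast this
  have hfr : frobSq (W1 * (Sd K eq t * W2) - W1 * (Sq * W2)) = Fintype.card a := by
    rw [← Matrix.mul_sub, ← Matrix.sub_mul, frobSq_isom_mul h1, frobSq_mul_coisom h2, Sd, hSq,
      diagonal_sub, frobSq_diagonal, ← eq.sum_comp, Fintype.sum_sum_type]
    simp
  refine ⟨W1 * (Sq * W2), ⟨?_, ?_⟩, hfr⟩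
  · refine (Matrix.rank_mul_le_right _ _).trans ((Matrix.rank_mul_le_left _ _).trans ?_)
    rw [hSq, Matrix.rank_diagonal]
    classical
    refine Fintype.card_le_of_surjective (fun j : s => ⟨eq (Sum.inl j), by
      rw [eq.symm_apply_apply]; exact ht0⟩) ?_
    rintro ⟨i, hi⟩
    rcases h : eq.symm i with j | j
    · exact ⟨j, Subtype.ext (by show eq (Sum.inl j) = i; rw [← h]; simp)⟩
    · simp [h] at hi
  · intro B hB
    rw [hfr]
    obtain ⟨X, hX1, hX2, hX3, hX4⟩ := hp B
    set A := W1 * (Sd K eq t * W2) with hA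
    set P := B * X with hP
    have hPP : P * P = P := by rw [hP, ← Matrix.mul_assoc, hX1]
    have hPB : P * B = B := hX1
    have horth : P * (1 - P) = 0 := by rw [Matrix.mul_sub, Matrix.mul_one, hPP, sub_self]
    have hdec : ∀ Y : Matrix d n K, frobSq Y = frobSq (P * Y) + frobSq ((1 - P) * Y) := by
      intro Y
      have h : Y = P * Y + (1 - P) * Y := by rw [← Matrix.add_mul]; simp
      conv_lhs => rw [h]
      apply frobSq_add
      rw [conjTranspose_mul, hX3, Matrix.mul_assoc, ← Matrix.mul_assoc P, horth]
      simp
    have e1 : frobSq ((1 - P) * A) ≤ frobSq (A - B) := by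
      have : (1 - P) * (A - B) = (1 - P) * A := by
        rw [Matrix.mul_sub, Matrix.sub_mul 1 P B, hPB]; simp
      rw [hdec (A - B), this]
      linarith [frobSq_nonneg (P * (A - B))]
    have e2 : frobSq A = Fintype.card s * t ^ 2 + Fintype.card a := by
      rw [hA, frobSq_isom_mul h1, frobSq_mul_coisom h2, Sd_frob]
    have e3 : frobSq P ≤ Fintype.card s := by
      have h5 : ((frobSq P : ℝ) : K) = ((P.rank : ℝ) : K) := by
        rw [frobSq_trace, hX3, hPP, trace_idem hPP]; simp
      have h6 : frobSq P = P.rank := by exact_mod_cast h5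
      rw [h6]
      exact_mod_cast (Matrix.rank_mul_le_left B X).trans hB
    have e4 : frobSq (P * A) ≤ t ^ 2 * Fintype.card s := by
      have : P * A = P * W1 * Sd K eq t * W2 := by rw [hA]; simp only [Matrix.mul_assoc]
      rw [this, frobSq_mul_coisom h2]
      refine (frobSq_mul_Sd_le eq ht _).trans ?_
      refine mul_le_mul_of_nonneg_left ?_ (by positivity)
      exact (frobSq_mul_isom_le h1 _).trans e3
    have := hdec A
    linarith

end eckart

section assembly
set_option linter.unusedSectionVars false
variable {K : Type*} [RCLike K] [MeasurableSpace K] [BorelSpace K]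
variable {d n ι κ a b b' c c' s ρ δ : Type*} [Fintype d] [Fintype n] [Fintype ι] [Fintype κ]
  [DecidableEq d] [DecidableEq n] [DecidableEq ι] [DecidableEq κ]
  [Fintype b] [DecidableEq b] [Fintype c] [DecidableEq c]
  [Fintype b'] [DecidableEq b'] [Fintype δ] [DecidableEq δ]
  [Fintype a] [DecidableEq a] [Fintype s] [DecidableEq s] [Fintype ρ] [DecidableEq ρ]
  {Y : Type*} [MeasurableSpace Y]

/-- the random test matrix before left rotation -/
def Bm (ed : ρ ⊕ δ ≃ d) (en : ρ ⊕ b' ≃ n) (S : Matrix ρ ρ K) (V : Matrix n n K) :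
    Matrix d n K :=
  Ec K (ed ∘ Sum.inl) * (S * ((Ec K (en ∘ Sum.inl))ᴴ * V))

lemma assembly (μ : Measure Y) [IsProbabilityMeasure μ] (eκ : κ ⊕ b ≃ d) (e : ι ⊕ c ≃ d)
    (ed : ρ ⊕ δ ≃ d) (en : ρ ⊕ b' ≃ n) (hιρ : Fintype.card ι ≤ Fintype.card ρ)
    (hc : (Fintype.card ι : ℝ) + alphaK K < Fintype.card κ)
    {S : Matrix ρ ρ K} (hS : IsUnit S.det)
    {Om : Y → Matrix n ι K} {Psi : Y → Matrix d κ K} (hOm : Measurable Om) (hPsi : Measurable Psi)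
    (hOF : ∀ᵐ ω ∂μ, FR (Om ω)) (hPF : ∀ᵐ ω ∂μ, FR (Psi ω)) {T : ℝ≥0∞}
    (hT : ∀ U ∈ Matrix.unitaryGroup d K, ∀ V ∈ Matrix.unitaryGroup n K,
      ∫⁻ ω, errM (Om ω) (Psi ω) (U * Bm ed en S V) ∂μ ≤ T) :
    ENNReal.ofReal (1 + ((Fintype.card b : ℝ) / Fintype.card c * (Fintype.card ι /
      ((Fintype.card κ : ℝ) - Fintype.card ι - alphaK K)))) *
      ∫⁻ C, rho (ι := ι) S C ∂(Gm K ρ ι) ≤ T := by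
  set c1 := ENNReal.ofReal (1 + ((Fintype.card b : ℝ) / Fintype.card c * (Fintype.card ι /
      ((Fintype.card κ : ℝ) - Fintype.card ι - alphaK K))))
  have hBm : Measurable fun V : Matrix n n K => Bm ed en S V :=
    meas_mul measurable_const (meas_mul measurable_const
      (meas_mul measurable_const measurable_id_mat))
  have hup : ∫⁻ V, ∫⁻ U, ∫⁻ ω, errM (Om ω) (Psi ω) (U * Bm ed en S V) ∂μ ∂(Hu K d) ∂(Hu K n)
      ≤ T := by
    calc _ ≤ ∫⁻ V : Matrix n n K, T ∂(Hu K n) := by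
          refine lintegral_mono_ae ?_
          filter_upwards [Hu_ae (K := K) (m := n)] with V hV
          calc _ ≤ ∫⁻ U : Matrix d d K, T ∂(Hu K d) := by
                refine lintegral_mono_ae ?_
                filter_upwards [Hu_ae (K := K) (m := d)] with U hU using hT U hU V hV
            _ = T := by simp
      _ = T := by simp
  refine le_trans ?_ hup
  have sw1 : ∀ V : Matrix n n K,
      ∫⁻ U, ∫⁻ ω, errM (Om ω) (Psi ω) (U * Bm ed en S V) ∂μ ∂(Hu K d) =
      ∫⁻ ω, ∫⁻ U, errM (Om ω) (Psi ω) (U * Bm ed en S V) ∂(Hu K d) ∂μ := by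
    intro V
    refine lintegral_lintegral_swap (Measurable.aemeasurable ?_)
    exact meas_errM (hOm.comp measurable_snd) (hPsi.comp measurable_snd)
      (meas_mul measurable_fst measurable_const)
  simp only [sw1]
  have hmeas : Measurable fun p : Matrix n n K × Y =>
      ∫⁻ U, errM (Om p.2) (Psi p.2) (U * Bm ed en S p.1) ∂(Hu K d) := by
    refine Measurable.lintegral_prod_right'
      (f := fun p : (Matrix n n K × Y) × Matrix d d K =>
        errM (Om p.1.2) (Psi p.1.2) (p.2 * Bm ed en S p.1.1)) ?_
    exact meas_errM (hOm.comp (measurable_snd.comp measurable_fst))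
      (hPsi.comp (measurable_snd.comp measurable_fst))
      (meas_mul measurable_snd (hBm.comp (measurable_fst.comp measurable_fst)))
  rw [lintegral_lintegral_swap (f := fun (V : Matrix n n K) (ω : Y) =>
    ∫⁻ U, errM (Om ω) (Psi ω) (U * Bm ed en S V) ∂(Hu K d)) hmeas.aemeasurable]
  have : c1 * ∫⁻ C, rho (ι := ι) S C ∂(Gm K ρ ι) =
      ∫⁻ ω : Y, c1 * ∫⁻ C, rho (ι := ι) S C ∂(Gm K ρ ι) ∂μ := by simp
  rw [this]
  refine lintegral_mono_ae ?_
  filter_upwards [hOF, hPF] with ω hΩ hΨ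
  have hmr : Measurable fun V : Matrix n n K => rho S ((Ec K (en ∘ Sum.inl))ᴴ * V * Om ω) :=
    (meas_rho S).comp (meas_mul (meas_mul measurable_const measurable_id_mat) measurable_const)
  rw [← avgV en (meas_rho S) (rho_unit S) hΩ, ← lintegral_const_mul _ hmr]
  refine lintegral_mono_ae ?_
  have hJ : FR (Ec K (en ∘ Sum.inl)) := FR_isom (Ec_isom (e_inl_inj en))
  filter_upwards [Hu_ae (K := K) (m := n), ae_FR_sketch en hJ hιρ hΩ] with V hV hC
  have hW1 := Ec_isom (K := K) (e_inl_inj ed)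
  have hW2 : ((Ec K (en ∘ Sum.inl))ᴴ * V) * ((Ec K (en ∘ Sum.inl))ᴴ * V)ᴴ = 1 := by
    rw [conjTranspose_mul, conjTranspose_conjTranspose, Matrix.mul_assoc, ← Matrix.mul_assoc V,
      unitary_right hV, Matrix.one_mul, Ec_isom (e_inl_inj en)]
  rw [← resid_eq hW1 hW2]
  refine avgU eκ e hΨ hc (B := Bm ed en S V) ?_
  have : Bm ed en S V * Om ω = Ec K (ed ∘ Sum.inl) * (S * ((Ec K (en ∘ Sum.inl))ᴴ * (V * Om ω))) := by
    unfold Bm; simp only [Matrix.mul_assoc]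
  rw [this]
  exact FR_mul (FR_isom hW1) (FR_mul (FR_unit hS) hC)

end assembly

/-- **Generalized Nyström, sharp lower bound** (Theorem 4.1(b)): for any full-rank
random embeddings `Ω`, `Ψ` with `ℓ + α_K < k`, and rank parameters `q + α_K ≤ ℓ`,
`k ≤ r ≤ min(d, n)`, the worst case over matrices `A` with `rank A = r` of
`E‖A − A⟨Ω,Ψ⟩‖_F² / ‖A − [A]_q‖_F²` is at least
`(1 + ((d − k)/(d − ℓ)) ℓ/(k − ℓ − α_K)) ((r − ℓ)/(r − q)) (1 + q/(ℓ − q − α_K))`. -/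
theorem generalized_nystrom_lower_bound
    {K : Type*} [RCLike K] [MeasurableSpace K] [BorelSpace K]
    {Y : Type*} [MeasurableSpace Y] (μ : Measure Y) [IsProbabilityMeasure μ]
    (pinv : (m n : ℕ) → Matrix (Fin m) (Fin n) K → Matrix (Fin n) (Fin m) K)
    (hpinv : ∀ (m n : ℕ) (A : Matrix (Fin m) (Fin n) K), IsMoorePenrose A (pinv m n A))
    (n ℓ d k q r : ℕ) (hℓn : ℓ ≤ n) (hkd : k ≤ d)
    (Om : Y → Matrix (Fin n) (Fin ℓ) K) (Psi : Y → Matrix (Fin d) (Fin k) K)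
    (hOmMeas : Measurable Om) (hPsiMeas : Measurable Psi)
    (hOmFull : ∀ᵐ ω ∂μ, (Om ω).rank = ℓ)
    (hPsiFull : ∀ᵐ ω ∂μ, (Psi ω).rank = k)
    (hℓk : (ℓ : ℝ) + alphaK K < (k : ℝ))
    (hq : (q : ℝ) + alphaK K ≤ (ℓ : ℝ)) (hkr : k ≤ r) (hrd : r ≤ d) (hrn : r ≤ n) :
    ENNReal.ofReal
        ((1 + ((d : ℝ) - (k : ℝ)) / ((d : ℝ) - (ℓ : ℝ)) *
            ((ℓ : ℝ) / ((k : ℝ) - (ℓ : ℝ) - alphaK K))) *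
          (((r : ℝ) - (ℓ : ℝ)) / ((r : ℝ) - (q : ℝ)) *
            (1 + (q : ℝ) / ((ℓ : ℝ) - (q : ℝ) - alphaK K)))) ≤
      ⨆ (A : Matrix (Fin d) (Fin n) K) (Aq : Matrix (Fin d) (Fin n) K)
        (_ : A.rank = r) (_ : IsBestRankApprox q A Aq),
        (∫⁻ ω, ENNReal.ofReal (frobSq (A - (A * Om ω) *
            (pinv k ℓ ((Psi ω)ᴴ * A * Om ω) * ((Psi ω)ᴴ * A)))) ∂μ) /
          ENNReal.ofReal (frobSq (A - Aq)) := by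

  classical
  have hα : 0 ≤ alphaK K := by unfold alphaK; split_ifs <;> simp
  have hℓk' : ℓ < k := by
    have : (ℓ : ℝ) < k := by linarith
    exact_mod_cast this
  have hqℓ : q ≤ ℓ := by
    have : (q : ℝ) ≤ ℓ := by linarith
    exact_mod_cast this
  set Tsup : ℝ≥0∞ := ⨆ (A : Matrix (Fin d) (Fin n) K) (Aq : Matrix (Fin d) (Fin n) K)
        (_ : A.rank = r) (_ : IsBestRankApprox q A Aq),
        (∫⁻ ω, ENNReal.ofReal (frobSq (A - (A * Om ω) *
            (pinv k ℓ ((Psi ω)ᴴ * A * Om ω) * ((Psi ω)ᴴ * A)))) ∂μ) /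
          ENNReal.ofReal (frobSq (A - Aq)) with hTsup
  let eκ : Fin k ⊕ Fin (d - k) ≃ Fin d := finSumFinEquiv.trans (finCongr (by omega))
  let eι : Fin ℓ ⊕ Fin (d - ℓ) ≃ Fin d := finSumFinEquiv.trans (finCongr (by omega))
  let ed : Fin r ⊕ Fin (d - r) ≃ Fin d := finSumFinEquiv.trans (finCongr (by omega))
  let en : Fin r ⊕ Fin (n - r) ≃ Fin n := finSumFinEquiv.trans (finCongr (by omega))
  let er : Fin ℓ ⊕ Fin (r - ℓ) ≃ Fin r := finSumFinEquiv.trans (finCongr (by omega))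
  let eq : Fin q ⊕ Fin (r - q) ≃ Fin r := finSumFinEquiv.trans (finCongr (by omega))
  have crq : ((r - q : ℕ) : ℝ) = (r : ℝ) - q := Nat.cast_sub (by omega)
  have crl : ((r - ℓ : ℕ) : ℝ) = (r : ℝ) - ℓ := Nat.cast_sub (by omega)
  have cdk : ((d - k : ℕ) : ℝ) = (d : ℝ) - k := Nat.cast_sub (by omega)
  have cdl : ((d - ℓ : ℕ) : ℝ) = (d : ℝ) - ℓ := Nat.cast_sub (by omega)
  have hrq : 0 < (r : ℝ) - q := by
    have : (q : ℝ) < r := by exact_mod_cast (by omega : q < r)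
    linarith
  set w := ENNReal.ofReal ((r : ℝ) - q) with hw
  have hw0 : w ≠ 0 := by rw [hw]; simpa using hrq
  have hwt : w ≠ ⊤ := ENNReal.ofReal_ne_top
  have hOF : ∀ᵐ ω ∂μ, FR (Om ω) := by
    filter_upwards [hOmFull] with ω h using FR_of_rank (by simpa using h)
  have hPF : ∀ᵐ ω ∂μ, FR (Psi ω) := by
    filter_upwards [hPsiFull] with ω h using FR_of_rank (by simpa using h)
  set x1 : ℝ := 1 + ((d : ℝ) - (k : ℝ)) / ((d : ℝ) - (ℓ : ℝ)) *
            ((ℓ : ℝ) / ((k : ℝ) - (ℓ : ℝ) - alphaK K)) with hx1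
  have hx1pos : 0 < x1 := by
    have h1 : 0 ≤ (d : ℝ) - k := by rw [← cdk]; positivity
    have h2 : 0 ≤ (d : ℝ) - ℓ := by rw [← cdl]; positivity
    have h3 : 0 ≤ (k : ℝ) - ℓ - alphaK K := by linarith
    have : 0 ≤ ((d : ℝ) - (k : ℝ)) / ((d : ℝ) - (ℓ : ℝ)) *
            ((ℓ : ℝ) / ((k : ℝ) - (ℓ : ℝ) - alphaK K)) := by positivity
    linarith
  have key : ∀ m : ℕ, ENNReal.ofReal x1 *
      ∫⁻ C, rho (ι := Fin ℓ) (Sd K eq ((m : ℝ) + 1)) C ∂(Gm K (Fin r) (Fin ℓ)) ≤ Tsup * w := by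
    intro m
    have hm1 : (1 : ℝ) ≤ (m : ℝ) + 1 := by
      have : (0 : ℝ) ≤ m := by positivity
      linarith
    have hSd := Sd_mul (K := K) eq (t := (m : ℝ) + 1) (by positivity)
    have uS : IsUnit (Sd K eq ((m : ℝ) + 1)).det := by
      rw [← Matrix.isUnit_iff_isUnit_det]
      exact ⟨⟨_, _, hSd, mul_eq_one_comm.1 hSd⟩, rfl⟩
    have h := assembly μ eκ eι ed en (by simp; omega) (by simpa using hℓk) uS hOmMeas hPsiMeas
      hOF hPF (T := Tsup * w) ?_
    · simpa [cdk, cdl, hx1] using h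
    intro U hU V hV
    have hW1 : (U * Ec K (ed ∘ Sum.inl))ᴴ * (U * Ec K (ed ∘ Sum.inl)) = 1 := by
      rw [conjTranspose_mul, Matrix.mul_assoc, ← Matrix.mul_assoc Uᴴ, unitary_left hU,
        Matrix.one_mul, Ec_isom (e_inl_inj ed)]
    have hW2 : ((Ec K (en ∘ Sum.inl))ᴴ * V) * ((Ec K (en ∘ Sum.inl))ᴴ * V)ᴴ = 1 := by
      rw [conjTranspose_mul, conjTranspose_conjTranspose, Matrix.mul_assoc, ← Matrix.mul_assoc V,
        unitary_right hV, Matrix.one_mul, Ec_isom (e_inl_inj en)]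
    have hAeq : U * Bm ed en (Sd K eq ((m : ℝ) + 1)) V = (U * Ec K (ed ∘ Sum.inl)) *
        (Sd K eq ((m : ℝ) + 1) * ((Ec K (en ∘ Sum.inl))ᴴ * V)) := by
      unfold Bm; simp only [Matrix.mul_assoc]
    have hrank := rank_A hW1 hW2 eq hm1
    obtain ⟨Aq, hbest, hfr⟩ := exists_best hW1 hW2 eq hm1 (fun B => ⟨_, hpinv _ _ B⟩)
    rw [← hAeq] at hrank hbest hfr
    set A := U * Bm ed en (Sd K eq ((m : ℝ) + 1)) V
    simp only [Fintype.card_fin] at hrank hbest hfr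
    have hle : (∫⁻ ω, ENNReal.ofReal (frobSq (A - (A * Om ω) *
            (pinv k ℓ ((Psi ω)ᴴ * A * Om ω) * ((Psi ω)ᴴ * A)))) ∂μ) /
          ENNReal.ofReal (frobSq (A - Aq)) ≤ Tsup :=
      le_iSup₂_of_le A Aq (le_iSup₂_of_le hrank hbest le_rfl)
    rw [hfr, crq, ← hw, ENNReal.div_le_iff hw0 hwt] at hle
    refine le_trans (lintegral_mono fun ω => ?_) hle
    exact errM_le _ _ _ (hpinv _ _ _)
  have h2 := step2 (K := K) er eq (by
    simp only [Fintype.card_fin]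
    rw [crl, crq]
    linarith)
  simp only [Fintype.card_fin] at h2
  rw [crl, crq] at h2
  have hc0 : ENNReal.ofReal x1 ≠ 0 := by simpa using hx1pos
  have hct : ENNReal.ofReal x1 ≠ ⊤ := ENNReal.ofReal_ne_top
  have h3 : liminf (fun m : ℕ => ∫⁻ C, rho (ι := Fin ℓ) (Sd K eq ((m : ℝ) + 1)) C
      ∂(Gm K (Fin r) (Fin ℓ))) atTop ≤ Tsup * w / ENNReal.ofReal x1 := by
    have : liminf (fun _ : ℕ => Tsup * w / ENNReal.ofReal x1) atTop = Tsup * w / ENNReal.ofReal x1 :=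
      liminf_const _
    rw [← this]
    refine liminf_le_liminf (Eventually.of_forall fun m => ?_)
    rw [ENNReal.le_div_iff_mul_le (Or.inl hc0) (Or.inl hct), mul_comm]
    exact key m
  have h4 := h2.trans h3
  rw [ENNReal.le_div_iff_mul_le (Or.inl hc0) (Or.inl hct)] at h4
  have hsplit : x1 * (((r : ℝ) - (ℓ : ℝ)) / ((r : ℝ) - (q : ℝ)) *
            (1 + (q : ℝ) / ((ℓ : ℝ) - (q : ℝ) - alphaK K))) =
      (((r : ℝ) - ℓ) * (1 + (q : ℝ) / ((r : ℝ) - q - (r - ℓ) - alphaK K))) * x1 / (r - q) := by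
    have : (r : ℝ) - q - (r - ℓ) - alphaK K = (ℓ : ℝ) - q - alphaK K := by ring
    rw [this]
    ring
  rw [hsplit, ENNReal.ofReal_div_of_pos hrq, ← hw, ENNReal.div_le_iff hw0 hwt,
    ENNReal.ofReal_mul' hx1pos.le]
  exact h4
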